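/- (Tightness of the lower bounds: existence of minimizers.) For every d ≥ 3, s ≥ 0 and n ≥ d+s+1 there exists a polytope P ∈ P(d,n,s) with f_i(P) = C(d,i)·n − C(d+1,i+1)·i for all 1 ≤ i ≤ d−3, f_{d−2}(P) = C(d,d−2)·n − C(d+1,d−1)·(d−2) − s, and f_{d−1}(P) = (d−1)·n − (d+1)(d−2) − s. (Here C(a,b) denotes the binomial coefficient.) -/

import Mathlib

open Finset

namespace ASP

noncomputable section

/-- The dot product of two vectors in `ℝ^d`. -/
def dotp {d : ℕ} (x y : Fin d → ℝ) : ℝ := ∑ i, x i * y i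

/-- `F` is a face of the polytope `P ⊆ ℝ^d`: the intersection of `P` with a supporting
hyperplane, together with the empty face and `P` itself. -/
def IsFaceOf {d : ℕ} (P F : Set (Fin d → ℝ)) : Prop :=
  F = ∅ ∨ F = P ∨
    ∃ (b : Fin d → ℝ) (c : ℝ), b ≠ 0 ∧ (∀ x ∈ P, dotp b x ≤ c) ∧
      F = {x ∈ P | dotp b x = c}

/-- The dimension of a subset of `ℝ^d`: the dimension of its affine span. -/
def polyDim {d : ℕ} (S : Set (Fin d → ℝ)) : ℕ :=
  Module.finrank ℝ (affineSpan ℝ S).direction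

/-- A polytope: the convex hull of a finite point set. -/
def IsPolytope {d : ℕ} (P : Set (Fin d → ℝ)) : Prop :=
  ∃ V : Finset (Fin d → ℝ), P = convexHull ℝ (V : Set (Fin d → ℝ))

/-- The vertex set of a polytope: its set of extreme points. -/
def verts {d : ℕ} (P : Set (Fin d → ℝ)) : Set (Fin d → ℝ) :=
  Set.extremePoints ℝ P

/-- `fVec P i` is the number of `i`-dimensional (nonempty) faces of `P`. -/
def fVec {d : ℕ} (P : Set (Fin d → ℝ)) (i : ℕ) : ℕ :=
  {F : Set (Fin d → ℝ) | IsFaceOf P F ∧ F.Nonempty ∧ polyDim F = i}.ncard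

/-- A facet of a `d`-polytope in `ℝ^d`: a `(d-1)`-dimensional face. -/
def IsFacetOf {d : ℕ} (P F : Set (Fin d → ℝ)) : Prop :=
  IsFaceOf P F ∧ F.Nonempty ∧ polyDim F = d - 1

/-- `(P, F)` is an ASP-pair: `P` is a `d`-polytope, `F` is a facet of `P`, and every facet
of `P` other than `F` is a simplex (i.e. has exactly `d` vertices). -/
def IsASPPair {d : ℕ} (P F : Set (Fin d → ℝ)) : Prop :=
  IsPolytope P ∧ polyDim P = d ∧ IsFacetOf P F ∧
    ∀ G, IsFacetOf P G → G ≠ F → (verts G).ncard = d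

/-- `P ∈ 𝒫(d,n,s)`: `P` is a `d`-polytope with `n` vertices such that `(P,F)` is an
ASP-pair where the facet `F` has `d + s` vertices. -/
def MemASP (d n s : ℕ) (P : Set (Fin d → ℝ)) : Prop :=
  (verts P).ncard = n ∧ ∃ F, IsASPPair P F ∧ (verts F).ncard = d + s

/-- `fBall P i` is `f_{i-1}(P')` of the simplicial ball `P' = ∂P - {F}` consisting of all
proper faces of `P` except its (unique non-simplex) facet `F`; the index is shifted by one,
so `fBall P 0 = f_{-1} = 1` counts the empty face, and at the top dimension the facet `F`
is discarded. -/
def fBall {d : ℕ} (P : Set (Fin d → ℝ)) (i : ℕ) : ℤ :=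
  if i = 0 then 1
  else if i = d then (fVec P (d - 1) : ℤ) - 1
  else if d < i then 0
  else (fVec P (i - 1) : ℤ)

/-- `hBall P k` is `h_k(P')` of the `(d-1)`-dimensional ball `P' = ∂P - {F}`, defined by
`h_k = ∑_{i=0}^{k} (-1)^{k-i} C(d-i, k-i) f_{i-1}(P')`, extended by `0` outside `0 ≤ k ≤ d`. -/
def hBall {d : ℕ} (P : Set (Fin d → ℝ)) (k : ℤ) : ℤ :=
  if 0 ≤ k ∧ k ≤ (d : ℤ) then
    ∑ i ∈ Finset.range (k.toNat + 1),
      (-1) ^ (k.toNat - i) * ((d - i).choose (k.toNat - i) : ℤ) * fBall P i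
  else 0

/-- `fBd m Q i` is `f_{i-1}(∂Q)` of the boundary complex of an `m`-polytope `Q ⊆ ℝ^d`
(a complex of dimension `m - 1`); the index is shifted by one. -/
def fBd {d : ℕ} (m : ℕ) (Q : Set (Fin d → ℝ)) (i : ℕ) : ℤ :=
  if i = 0 then 1 else if m + 1 ≤ i then 0 else (fVec Q (i - 1) : ℤ)

/-- `hBd m Q k` is `h_k(∂Q)` for the boundary complex of an `m`-polytope `Q ⊆ ℝ^d`, defined by
`h_k = ∑_{i=0}^{k} (-1)^{k-i} C(m-i, k-i) f_{i-1}(∂Q)`, extended by `0` outside `0 ≤ k ≤ m`. -/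
def hBd {d : ℕ} (m : ℕ) (Q : Set (Fin d → ℝ)) (k : ℤ) : ℤ :=
  if 0 ≤ k ∧ k ≤ (m : ℤ) then
    ∑ i ∈ Finset.range (k.toNat + 1),
      (-1) ^ (k.toNat - i) * ((m - i).choose (k.toNat - i) : ℤ) * fBd m Q i
  else 0

/-- `gBd m Q k = g_k(∂Q) = h_k(∂Q) - h_{k-1}(∂Q)`. -/
def gBd {d : ℕ} (m : ℕ) (Q : Set (Fin d → ℝ)) (k : ℤ) : ℤ :=
  hBd m Q k - hBd m Q (k - 1)

/-- The function `p(t) = (n-1)^{(t-1)(d-1)} · t(t+1)⋯(t+d+s-1)` (real exponentiation of the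
positive base `n-1`) used to define the almost cyclic polytope. -/
def acp (d n s : ℕ) (t : ℝ) : ℝ :=
  ((n : ℝ) - 1) ^ ((t - 1) * ((d : ℝ) - 1)) * ∏ l ∈ Finset.range (d + s), (t + l)

/-- The curve `y(t) = (t, t², …, t^{d-1}, p(t)) ∈ ℝ^d`. -/
def acy (d n s : ℕ) (t : ℝ) : Fin d → ℝ :=
  fun i => if (i : ℕ) + 1 = d then acp d n s t else t ^ ((i : ℕ) + 1)

/-- The parameter values `t_i = -s - d + i` for `i = 1, …, n` (here `0`-indexed:
`acT d s j = t_{j+1}`). -/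
def acT (d s j : ℕ) : ℝ := (j : ℝ) + 1 - s - d

/-- The `n` points `y(t_1), …, y(t_n)` on the curve `y` (`0`-indexed). -/
def acPoint (d n s : ℕ) (j : Fin n) : Fin d → ℝ := acy d n s (acT d s (j : ℕ))

/-- The almost cyclic polytope `C(d,n,s) = conv{y(t_1), …, y(t_n)}`. -/
def acPolytope (d n s : ℕ) : Set (Fin d → ℝ) :=
  convexHull ℝ (Set.range (acPoint d n s))

/-- The non-simplex facet `F = conv{y(t_1), …, y(t_{d+s})}` of the almost cyclic polytope. -/
def acFacet (d n s : ℕ) : Set (Fin d → ℝ) :=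
  convexHull ℝ (acPoint d n s '' {j : Fin n | (j : ℕ) < d + s})

/-- The generalized moment curve
`x(t) = (t, t², …, t^{d-r}, p_1(t), …, p_r(t)) ∈ ℝ^d`. -/
def gmc (d r : ℕ) (p : Fin r → ℝ → ℝ) (t : ℝ) : Fin d → ℝ :=
  fun i =>
    if h : (i : ℕ) < d - r then t ^ ((i : ℕ) + 1)
    else p ⟨(i : ℕ) - (d - r), by have h2 := i.2; omega⟩ t

/-- A polytope is `k`-neighborly if each subset of at most `k` of its vertices is the
vertex set of a face. -/
def IsNeighborly {d : ℕ} (k : ℕ) (P : Set (Fin d → ℝ)) : Prop :=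
  ∀ S : Finset (Fin d → ℝ), (S : Set (Fin d → ℝ)) ⊆ verts P → S.card ≤ k →
    ∃ G : Set (Fin d → ℝ), IsFaceOf P G ∧ verts G = (S : Set (Fin d → ℝ))

/-- The point `y` is beyond the facet `F` of the polytope `P`: for every supporting
hyperplane of `P` cutting out a facet, `y` is strictly on the outer side if the facet is `F`,
and strictly on the inner side otherwise. -/
def IsBeyond {d : ℕ} (P F : Set (Fin d → ℝ)) (y : Fin d → ℝ) : Prop :=
  ∀ (b : Fin d → ℝ) (c : ℝ), b ≠ 0 → (∀ x ∈ P, dotp b x ≤ c) →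
    IsFacetOf P {x ∈ P | dotp b x = c} →
      (({x ∈ P | dotp b x = c} = F → c < dotp b y) ∧
       ({x ∈ P | dotp b x = c} ≠ F → dotp b y < c))

theorem dotp_add {d : ℕ} (b x y : Fin d → ℝ) (s t : ℝ) :
    dotp b (s • x + t • y) = s * dotp b x + t * dotp b y := by
  simp only [dotp, Finset.mul_sum, ← Finset.sum_add_distrib]
  refine Finset.sum_congr rfl fun i _ => ?_
  simp; ring

theorem dotp_sum {d : ℕ} {ι : Type*} (b : Fin d → ℝ) (v : ι → Fin d → ℝ) (w : ι → ℝ)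
    (A : Finset ι) : dotp b (∑ i ∈ A, w i • v i) = ∑ i ∈ A, w i * dotp b (v i) := by
  simp only [dotp, Finset.mul_sum, Finset.sum_apply, Pi.smul_apply, smul_eq_mul]
  rw [Finset.sum_comm]
  refine Finset.sum_congr rfl fun i _ => Finset.sum_congr rfl fun j _ => by ring

theorem mem_hull {d : ℕ} {ι : Type*} [DecidableEq ι] (v : ι → Fin d → ℝ) (A : Finset ι)
    (x : Fin d → ℝ) : x ∈ convexHull ℝ (v '' (A : Set ι)) ↔
      ∃ w : ι → ℝ, (∀ i ∈ A, 0 ≤ w i) ∧ ∑ i ∈ A, w i = 1 ∧ ∑ i ∈ A, w i • v i = x := by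
  constructor
  · intro hx
    let C : Set (Fin d → ℝ) := {x | ∃ w : ι → ℝ, (∀ i ∈ A, 0 ≤ w i) ∧ ∑ i ∈ A, w i = 1 ∧
      ∑ i ∈ A, w i • v i = x}
    have hC : Convex ℝ C := by
      rintro x ⟨w, h0, h1, rfl⟩ y ⟨w', h0', h1', rfl⟩ s t hs ht hst
      refine ⟨fun i => s * w i + t * w' i, fun i hi => ?_, ?_, ?_⟩
      · have := h0 i hi
        have := h0' i hi
        positivity
      · rw [Finset.sum_add_distrib, ← Finset.mul_sum, ← Finset.mul_sum, h1, h1']; linarith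
      · simp only [add_smul, Finset.sum_add_distrib, Finset.smul_sum, mul_smul]
    have hsub : v '' (A : Set ι) ⊆ C := by
      rintro _ ⟨i, hi, rfl⟩
      have hi' : i ∈ A := hi
      refine ⟨fun j => if j = i then 1 else 0, fun j _ => by dsimp only; split_ifs <;> norm_num, ?_, ?_⟩
      · simp [hi']
      · simp [hi']
    exact convexHull_min hsub hC hx
  · rintro ⟨w, h0, h1, rfl⟩
    exact (convex_convexHull ℝ _).sum_mem h0 h1
      (fun i hi => subset_convexHull ℝ _ ⟨i, hi, rfl⟩)

theorem hull_le {d : ℕ} {ι : Type*} [DecidableEq ι] (v : ι → Fin d → ℝ) (A : Finset ι)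
    (b : Fin d → ℝ) (c : ℝ) (h : ∀ i ∈ A, dotp b (v i) ≤ c) :
    ∀ x ∈ convexHull ℝ (v '' (A : Set ι)), dotp b x ≤ c := by
  intro x hx
  obtain ⟨w, h0, h1, rfl⟩ := (mem_hull v A x).1 hx
  rw [dotp_sum]
  calc ∑ i ∈ A, w i * dotp b (v i) ≤ ∑ i ∈ A, w i * c :=
        Finset.sum_le_sum fun i hi => mul_le_mul_of_nonneg_left (h i hi) (h0 i hi)
    _ = c := by rw [← Finset.sum_mul, h1, one_mul]

theorem face_hull {d : ℕ} {ι : Type*} [DecidableEq ι] (v : ι → Fin d → ℝ) (A B : Finset ι)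
    (b : Fin d → ℝ) (c : ℝ) (h : ∀ i ∈ A, dotp b (v i) ≤ c)
    (hB : ∀ i, i ∈ B ↔ i ∈ A ∧ dotp b (v i) = c) :
    {x ∈ convexHull ℝ (v '' (A : Set ι)) | dotp b x = c} = convexHull ℝ (v '' (B : Set ι)) := by
  have hBA : B ⊆ A := fun i hi => ((hB i).1 hi).1
  ext x
  constructor
  · rintro ⟨hx, hc⟩
    obtain ⟨w, h0, h1, rfl⟩ := (mem_hull v A x).1 hx
    rw [dotp_sum] at hc
    have hz : ∑ i ∈ A, w i * (c - dotp b (v i)) = 0 := by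
      simp only [mul_sub, Finset.sum_sub_distrib, hc, ← Finset.sum_mul, h1]; ring
    rw [Finset.sum_eq_zero_iff_of_nonneg
      (fun i hi => mul_nonneg (h0 i hi) (sub_nonneg.2 (h i hi)))] at hz
    have hw : ∀ i ∈ A, i ∉ B → w i = 0 := by
      intro i hi hiB
      rcases mul_eq_zero.1 (hz i hi) with h2 | h2
      · exact h2
      · exact absurd ((hB i).2 ⟨hi, by linarith⟩) hiB
    rw [mem_hull]
    refine ⟨w, fun i hi => h0 i (hBA hi), ?_, ?_⟩
    · rw [← h1]; exact Finset.sum_subset hBA hw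
    · exact Finset.sum_subset hBA fun i hi hiB => by rw [hw i hi hiB, zero_smul]
  · intro hx
    refine ⟨convexHull_mono (Set.image_mono (by exact_mod_cast hBA)) hx, ?_⟩
    obtain ⟨w, h0, h1, rfl⟩ := (mem_hull v B x).1 hx
    rw [dotp_sum]
    calc ∑ i ∈ B, w i * dotp b (v i) = ∑ i ∈ B, w i * c :=
          Finset.sum_congr rfl fun i hi => by rw [((hB i).1 hi).2]
      _ = c := by rw [← Finset.sum_mul, h1, one_mul]

theorem verts_hull {d : ℕ} {ι : Type*} [DecidableEq ι] (v : ι → Fin d → ℝ) (A : Finset ι)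
    (hA : ∀ i ∈ A, ∃ b c, (∀ j ∈ A, dotp b (v j) ≤ c) ∧ ∀ j ∈ A, dotp b (v j) = c ↔ j = i) :
    verts (convexHull ℝ (v '' (A : Set ι))) = v '' (A : Set ι) := by
  refine Set.Subset.antisymm extremePoints_convexHull_subset ?_
  rintro _ ⟨i, hi, rfl⟩
  have hi' : i ∈ A := hi
  obtain ⟨b, c, h1, h2⟩ := hA i hi
  have hf := face_hull v A {i} b c h1 (fun j => by
    simp only [Finset.mem_singleton]
    constructor
    · rintro rfl; exact ⟨hi', (h2 j hi').2 rfl⟩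
    · rintro ⟨h3, h4⟩; exact (h2 j h3).1 h4)
  rw [verts, mem_extremePoints]
  refine ⟨subset_convexHull ℝ _ ⟨i, hi, rfl⟩, fun x hx y hy hxy => ?_⟩
  obtain ⟨s, t, hs, ht, hst, he⟩ := hxy
  have hc : dotp b (v i) = c := (h2 i hi').2 rfl
  have hx1 := hull_le v A b c h1 x hx
  have hy1 := hull_le v A b c h1 y hy
  rw [← he, dotp_add] at hc
  have ht' : t = 1 - s := by linarith
  have hxc : dotp b x = c := by
    by_contra hne
    have : dotp b x < c := lt_of_le_of_ne hx1 hne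
    have := mul_lt_mul_of_pos_left this hs
    have := mul_le_mul_of_nonneg_left hy1 ht.le
    subst ht'
    linarith
  have hyc : dotp b y = c := by
    by_contra hne
    have : dotp b y < c := lt_of_le_of_ne hy1 hne
    have := mul_lt_mul_of_pos_left this ht
    have := mul_le_mul_of_nonneg_left hx1 hs.le
    subst ht'
    linarith
  have key : ∀ z, z ∈ convexHull ℝ (v '' (A : Set ι)) → dotp b z = c → z = v i := by
    intro z hz hzc
    have : z ∈ {x ∈ convexHull ℝ (v '' (A : Set ι)) | dotp b x = c} := ⟨hz, hzc⟩
    rw [hf] at this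
    simpa using this
  exact ⟨key x hx hxc, key y hy hyc⟩

theorem polyDim_hull {d : ℕ} (X : Set (Fin d → ℝ)) :
    polyDim (convexHull ℝ X) = Module.finrank ℝ (vectorSpan ℝ X) := by
  rw [polyDim, affineSpan_convexHull, direction_affineSpan]

/-- affine independence via dual functionals -/
theorem dim_indep {d : ℕ} {ι : Type*} [DecidableEq ι] (v : ι → Fin d → ℝ) (A : Finset ι)
    (hA : ∀ i ∈ A, ∃ b c, dotp b (v i) ≠ c ∧ ∀ j ∈ A, j ≠ i → dotp b (v j) = c)
    (n : ℕ) (hn : A.card = n + 1) :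
    polyDim (convexHull ℝ (v '' (A : Set ι))) = n := by
  have hind : AffineIndependent ℝ (fun i : A => v i) := by
    rw [affineIndependent_iff]
    intro t w hw hwv i hi
    obtain ⟨b, c, h1, h2⟩ := hA i i.2
    have h3 := dotp_sum b (fun i : A => v i) w t
    rw [hwv] at h3
    have h4 : dotp b (0 : Fin d → ℝ) = 0 := by simp [dotp]
    rw [h4] at h3
    have h5 : ∑ j ∈ t, w j * (dotp b (v j) - c) = 0 := by
      simp only [mul_sub, Finset.sum_sub_distrib, ← Finset.sum_mul, hw, ← h3]; ring
    rw [Finset.sum_eq_single i] at h5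
    · rcases mul_eq_zero.1 h5 with h6 | h6
      · exact h6
      · exact absurd (by linarith) h1
    · intro j _ hji
      rw [h2 j j.2 (fun h => hji (Subtype.ext h))]; ring
    · intro h; exact absurd hi h
  have := hind.finrank_vectorSpan (n := n) (by simpa using hn)
  rw [polyDim_hull]
  have hr : Set.range (fun i : A => v i) = v '' (A : Set ι) := by ext x; simp
  rw [← hr, this]

def qq (s x : ℕ) : ℝ := ((x - (s + 1) : ℕ) : ℝ) ^ 2

def aa (r s : ℕ) (k : Fin (r + 1)) (j : ℕ) : ℝ :=
  if k = Fin.last r then qq s j else (j : ℝ) ^ 2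

def gg (r s : ℕ) (lam : Fin (r + 1) → ℝ) (al be : ℝ) (j : ℕ) : ℝ :=
  ∑ k, lam k * aa r s k j + al + be * j

theorem qq_lo {s x : ℕ} (h : x ≤ s + 1) : qq s x = 0 := by
  simp [qq, Nat.sub_eq_zero_of_le h]

theorem qq_hi {s x : ℕ} (h : s + 1 ≤ x) : qq s x = ((x : ℝ) - (s + 1)) ^ 2 := by
  rw [qq, Nat.cast_sub h]; push_cast; ring

theorem qq_nonneg (s x : ℕ) : 0 ≤ qq s x := by unfold qq; positivity

theorem aa_nonneg (r s : ℕ) (k : Fin (r + 1)) (j : ℕ) : 0 ≤ aa r s k j := by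
  unfold aa; split_ifs
  · exact qq_nonneg s j
  · positivity

theorem gg_eq (r s : ℕ) (lam : Fin (r + 1) → ℝ) (al be : ℝ) (j : ℕ) :
    gg r s lam al be j = (∑ k : Fin r, lam k.castSucc) * (j : ℝ) ^ 2
      + lam (Fin.last r) * qq s j + al + be * j := by
  rw [gg, Fin.sum_univ_castSucc, Finset.sum_mul]
  simp [aa, Fin.castSucc_ne_last]

/-- tangent lines of `qq` -/
theorem qq_tan (s y : ℕ) : ∃ σ : ℝ, ∀ x : ℕ, qq s y + σ * ((x : ℝ) - y) ≤ qq s x := by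
  rcases le_total y (s + 1) with h | h
  · refine ⟨0, fun x => ?_⟩
    rw [qq_lo h]; have := qq_nonneg s x; linarith
  · refine ⟨2 * ((y : ℝ) - (s + 1)), fun x => ?_⟩
    rw [qq_hi h]
    have h' : ((s : ℝ) + 1) ≤ y := by exact_mod_cast h
    rcases le_total x (s + 1) with h2 | h2
    · rw [qq_lo h2]
      have h2' : (x : ℝ) ≤ (s : ℝ) + 1 := by exact_mod_cast h2
      nlinarith
    · rw [qq_hi h2]; nlinarith [sq_nonneg ((x : ℝ) - y)]

theorem int_prod (x j : ℕ) : 0 ≤ ((x : ℝ) - j) * ((x : ℝ) - j - 1) ∧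
    (((x : ℝ) - j) * ((x : ℝ) - j - 1) = 0 ↔ x = j ∨ x = j + 1) := by
  rcases Nat.lt_or_ge x j with h | h
  · have h' : (x : ℝ) + 1 ≤ j := by exact_mod_cast h
    have : 0 < ((x : ℝ) - j) * ((x : ℝ) - j - 1) := by nlinarith
    refine ⟨this.le, ⟨fun h => absurd h this.ne', by omega⟩⟩
  · obtain ⟨u, rfl⟩ := Nat.exists_eq_add_of_le h
    rcases Nat.lt_or_ge u 2 with h2 | h2
    · interval_cases u <;> simp
    · have h2' : (2 : ℝ) ≤ u := by exact_mod_cast h2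
      have : 0 < (((j + u : ℕ) : ℝ) - j) * (((j + u : ℕ) : ℝ) - j - 1) := by
        push_cast; nlinarith
      refine ⟨this.le, ⟨fun h => absurd h this.ne', by omega⟩⟩

theorem qq_sec_lt {s j x : ℕ} (h : s + 1 ≤ j) (hx : x < s + 1) :
    ((j : ℝ) - (s + 1)) ^ 2 + (2 * ((j : ℝ) - (s + 1)) + 1) * ((x : ℝ) - j) < 0 := by
  have h' : ((s : ℝ) + 1) ≤ j := by exact_mod_cast h
  have h2' : (x : ℝ) + 1 ≤ (s : ℝ) + 1 := by exact_mod_cast hx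
  nlinarith [mul_nonneg (sub_nonneg.2 h') (sub_nonneg.2 h'), mul_nonneg (sub_nonneg.2 h') (sub_nonneg.2 h2')]

/-- secant lines of `qq` -/
theorem qq_sec_hi {s j : ℕ} (h : s + 1 ≤ j) (x : ℕ) :
    0 ≤ qq s x - (((j : ℝ) - (s + 1)) ^ 2 + (2 * ((j : ℝ) - (s + 1)) + 1) * ((x : ℝ) - j)) ∧
    (qq s x - (((j : ℝ) - (s + 1)) ^ 2 + (2 * ((j : ℝ) - (s + 1)) + 1) * ((x : ℝ) - j)) = 0 ↔
      x = j ∨ x = j + 1) := by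
  rcases Nat.lt_or_ge x (s + 1) with hx | hx
  · have := qq_sec_lt h hx
    rw [qq_lo hx.le]
    refine ⟨by linarith, ⟨fun h => by linarith, by omega⟩⟩
  · rw [qq_hi hx]
    have e : ((x : ℝ) - (s + 1)) ^ 2 - (((j : ℝ) - (s + 1)) ^ 2
      + (2 * ((j : ℝ) - (s + 1)) + 1) * ((x : ℝ) - j)) = ((x : ℝ) - j) * ((x : ℝ) - j - 1) := by
      ring
    rw [e]; exact int_prod x j

theorem qq_sec (s j : ℕ) : ∃ σ τ : ℝ, (∀ x : ℕ, 0 ≤ qq s x + τ + σ * x) ∧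
    qq s j + τ + σ * j = 0 ∧ qq s (j + 1) + τ + σ * ((j + 1 : ℕ) : ℝ) = 0 := by
  rcases Nat.lt_or_ge j (s + 1) with h | h
  · refine ⟨0, 0, fun x => ?_, ?_, ?_⟩
    · have := qq_nonneg s x; linarith
    · rw [qq_lo h.le]; ring
    · rw [qq_lo (by omega)]; ring
  · refine ⟨-(2 * ((j : ℝ) - (s + 1)) + 1),
      (2 * ((j : ℝ) - (s + 1)) + 1) * j - ((j : ℝ) - (s + 1)) ^ 2, fun x => ?_, ?_, ?_⟩
    · have := (qq_sec_hi h x).1; linarith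
    · have := ((qq_sec_hi h j).2).2 (Or.inl rfl); linarith
    · have := ((qq_sec_hi h (j + 1)).2).2 (Or.inr rfl); linarith

/-- strict supporting line of `qq` at a point `≥ s+1` -/
theorem qq_strict {s j : ℕ} (h : s + 1 ≤ j) (x : ℕ) :
    0 ≤ qq s x - (((j : ℝ) - (s + 1)) ^ 2 + (2 * ((j : ℝ) - (s + 1)) + 1 / 2) * ((x : ℝ) - j)) ∧
    (qq s x - (((j : ℝ) - (s + 1)) ^ 2 + (2 * ((j : ℝ) - (s + 1)) + 1 / 2) * ((x : ℝ) - j)) = 0 ↔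
      x = j) := by
  have h' : ((s : ℝ) + 1) ≤ j := by exact_mod_cast h
  rcases lt_trichotomy x j with hx | hx | hx
  · have : 0 < qq s x - (((j : ℝ) - (s + 1)) ^ 2
        + (2 * ((j : ℝ) - (s + 1)) + 1 / 2) * ((x : ℝ) - j)) := by
      have hx' : (x : ℝ) < j := by exact_mod_cast hx
      rcases le_total x (s + 1) with h2 | h2
      · have h2' : (x : ℝ) ≤ (s : ℝ) + 1 := by exact_mod_cast h2
        rw [qq_lo h2]
        nlinarith [mul_nonneg (sub_nonneg.2 h') (sub_nonneg.2 h'),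
          mul_nonneg (sub_nonneg.2 h') (sub_nonneg.2 h2')]
      · rw [qq_hi h2]; nlinarith [sq_nonneg ((x : ℝ) - j)]
    exact ⟨this.le, ⟨fun h => absurd h this.ne', by omega⟩⟩
  · subst hx
    rw [qq_hi h]; simp
  · have hx' : (j : ℝ) + 1 ≤ x := by exact_mod_cast hx
    have : 0 < qq s x - (((j : ℝ) - (s + 1)) ^ 2
        + (2 * ((j : ℝ) - (s + 1)) + 1 / 2) * ((x : ℝ) - j)) := by
      rw [qq_hi (by omega)]; nlinarith
    exact ⟨this.le, ⟨fun h => absurd h this.ne', by omega⟩⟩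

def Expo (r s m : ℕ) (K : Finset (Fin (r + 1))) (J : Finset ℕ) : Prop :=
  ∃ (lam : Fin (r + 1) → ℝ) (al be : ℝ), (∀ k, 0 ≤ lam k) ∧ (∀ j ≤ m, 0 ≤ gg r s lam al be j) ∧
    (∀ k, k ∈ K ↔ lam k = 0) ∧ (∀ j, j ∈ J ↔ j ≤ m ∧ gg r s lam al be j = 0)

def Val (r s m : ℕ) (K : Finset (Fin (r + 1))) (J : Finset ℕ) : Prop :=
  (K = univ ∧ (J = ∅ ∨ J = {0} ∨ J = {m} ∨ J = range (m + 1))) ∨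
  ((∃ k : Fin r, k.castSucc ∉ K) ∧
    (J = ∅ ∨ (∃ j ≤ m, J = {j}) ∨ ∃ j < m, J = {j, j + 1})) ∨
  (K = univ.erase (Fin.last r) ∧
    (J = ∅ ∨ (∃ j ≤ m, (j = 0 ∨ s + 1 ≤ j) ∧ J = {j}) ∨
      (∃ j < m, s + 1 ≤ j ∧ J = {j, j + 1}) ∨ J = range (s + 2)))

theorem three_case (J : Finset ℕ) (h : ∀ j ∈ J, ∀ j' ∈ J, j' < j + 2) :
    J = ∅ ∨ (∃ j ∈ J, J = {j}) ∨ ∃ j, j ∈ J ∧ j + 1 ∈ J ∧ J = {j, j + 1} := by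
  rcases J.eq_empty_or_nonempty with h0 | h0
  · exact Or.inl h0
  right
  have hm := J.min'_mem h0
  have hle : ∀ x ∈ J, J.min' h0 ≤ x := fun x hx => J.min'_le x hx
  generalize J.min' h0 = j at hm hle
  by_cases h1 : j + 1 ∈ J
  · right
    refine ⟨j, hm, h1, ?_⟩
    ext x
    simp only [Finset.mem_insert, Finset.mem_singleton]
    constructor
    · intro hx
      have := hle x hx
      have := h j hm x hx
      omega
    · rintro (rfl | rfl) <;> assumption
  · left
    refine ⟨j, hm, ?_⟩
    ext x
    simp only [Finset.mem_singleton]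
    constructor
    · intro hx
      have h2 := hle x hx
      have h3 := h j hm x hx
      rcases Nat.lt_or_ge j x with h4 | h4
      · have : x = j + 1 := by omega
        exact absurd (this ▸ hx) h1
      · omega
    · rintro rfl; exact hm

theorem val_of_expo {r s m : ℕ} (hm : s + 1 ≤ m) {K : Finset (Fin (r + 1))} {J : Finset ℕ}
    (h : Expo r s m K J) : Val r s m K J := by
  obtain ⟨lam, al, be, hl, hg, hK, hJ⟩ := h
  simp only [gg_eq] at hg hJ
  have hJm : ∀ j ∈ J, j ≤ m := fun j hj => ((hJ j).1 hj).1
  have hJ0 := fun j hj => ((hJ j).1 hj).2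
  set Λ := ∑ k : Fin r, lam k.castSucc with hΛ
  set μ := lam (Fin.last r) with hμ
  have hμ0 : 0 ≤ μ := hl _
  by_cases hc : ∃ k : Fin r, k.castSucc ∉ K
  · right; left
    refine ⟨hc, ?_⟩
    obtain ⟨k, hk⟩ := hc
    have hΛ0 : 0 < Λ := by
      apply Finset.sum_pos' (fun i _ => hl _)
      exact ⟨k, Finset.mem_univ _, lt_of_le_of_ne (hl _) (fun h => hk ((hK _).2 h.symm))⟩
    suffices h3 : ∀ j ∈ J, ∀ j' ∈ J, j' < j + 2 by
      rcases three_case J h3 with h | ⟨j, hj, h⟩ | ⟨j, hj, hj1, h⟩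
      · exact Or.inl h
      · exact Or.inr (Or.inl ⟨j, hJm j hj, h⟩)
      · exact Or.inr (Or.inr ⟨j, hJm _ hj1, h⟩)
    intro j hj j' hj'
    by_contra hlt
    push Not at hlt
    obtain ⟨σ, hσ⟩ := qq_tan s (j + 1)
    have e1 := hJ0 j hj
    have e2 := hJ0 j' hj'
    have e3 := hg (j + 1) (by have := hJm j' hj'; omega)
    have t1 := mul_le_mul_of_nonneg_left (hσ j) hμ0
    have t2 := mul_le_mul_of_nonneg_left (hσ j') hμ0
    obtain ⟨u, rfl⟩ := Nat.exists_eq_add_of_le hlt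
    push_cast at *
    set G := Λ * ((j : ℝ) + 1) ^ 2 + μ * qq s (j + 1) + al + be * (j + 1) with hG
    have hu : (0 : ℝ) ≤ u := by positivity
    have k1 : G - (2 * Λ * (j + 1) + μ * σ + be) + Λ ≤ 0 := by rw [hG]; nlinarith
    have k2 : G + (2 * Λ * (j + 1) + μ * σ + be) * (u + 1) + Λ * (u + 1) ^ 2 ≤ 0 := by
      rw [hG]; nlinarith
    have k3 : 0 < 2 * Λ * (j + 1) + μ * σ + be := by linarith
    have : 0 < (2 * Λ * (j + 1) + μ * σ + be) * (u + 1) := by positivity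
    have : 0 < Λ * ((u : ℝ) + 1) ^ 2 := by positivity
    linarith
  · push Not at hc
    have hΛ0 : Λ = 0 := Finset.sum_eq_zero fun k _ => (hK _).1 (hc k)
    simp only [hΛ0, zero_mul, zero_add] at hg hJ hJ0
    by_cases hlast : Fin.last r ∈ K
    · left
      have hμ1 : μ = 0 := (hK _).1 hlast
      refine ⟨Finset.eq_univ_iff_forall.2 (fun k => Fin.lastCases hlast hc k), ?_⟩
      simp only [hμ1, zero_mul, zero_add] at hg hJ hJ0
      by_cases hab : al = 0 ∧ be = 0
      · right; right; right
        ext j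
        rw [hJ, Finset.mem_range, hab.1, hab.2]
        simp
      · have huniq : ∀ j ∈ J, ∀ j' ∈ J, j = j' := by
          intro j hj j' hj'
          by_contra hne
          have e1 := hJ0 j hj
          have e2 := hJ0 j' hj'
          have : be * ((j : ℝ) - j') = 0 := by linarith
          rcases mul_eq_zero.1 this with h | h
          · apply hab; rw [h] at e1; exact ⟨by linarith, h⟩
          · exact hne (by exact_mod_cast sub_eq_zero.1 h)
        rcases J.eq_empty_or_nonempty with h0 | ⟨j, hj⟩
        · exact Or.inl h0
        have hJe : J = {j} := by
          ext x; simp only [Finset.mem_singleton]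
          exact ⟨fun hx => huniq x hx j hj, fun hx => hx ▸ hj⟩
        by_cases hj0 : j = 0
        · right; left; rw [hJe, hj0]
        by_cases hjm : j = m
        · right; right; left; rw [hJe, hjm]
        exfalso
        have hjm' := hJm j hj
        obtain ⟨i, rfl⟩ := Nat.exists_eq_succ_of_ne_zero hj0
        have e0 := hJ0 _ hj
        have e1 := hg i (by omega)
        have e2 := hg (i + 1 + 1) (by omega)
        push_cast at *
        have : be = 0 := by linarith
        apply hab
        refine ⟨?_, this⟩
        rw [this] at e0; linarith
    · right; right
      have hμ1 : 0 < μ := lt_of_le_of_ne hμ0 fun h => hlast ((hK _).2 h.symm)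
      constructor
      · ext k
        simp only [Finset.mem_erase, Finset.mem_univ, and_true]
        refine Fin.lastCases ?_ (fun i => ?_) k
        · simp [hlast]
        · simp [hc i, Fin.castSucc_ne_last]
      by_cases hab : al = 0 ∧ be = 0
      · right; right; right
        ext j
        rw [hJ, Finset.mem_range, hab.1, hab.2]
        constructor
        · rintro ⟨h1, h2⟩
          by_contra h3
          rw [qq_hi (by omega)] at h2
          have h3' : (s : ℝ) + 1 < j := by
            have : s + 1 < j := by omega
            exact_mod_cast this
          have : 0 < μ * ((j : ℝ) - (s + 1)) ^ 2 := by
            have : 0 < (j : ℝ) - (s + 1) := by linarith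
            positivity
          linarith
        · intro h
          refine ⟨by omega, ?_⟩
          rw [qq_lo (by omega)]; ring
      -- interior points of the flat part do not occur
      have hflat : ∀ j ∈ J, j = 0 ∨ s + 1 ≤ j := by
        intro j hj
        by_contra hcon
        push Not at hcon
        obtain ⟨i, rfl⟩ := Nat.exists_eq_succ_of_ne_zero hcon.1
        have e0 := hJ0 _ hj
        have e1 := hg i (by omega)
        have e2 := hg (i + 1 + 1) (by omega)
        rw [qq_lo (by omega)] at e0 e1 e2
        push_cast at *
        have : be = 0 := by linarith
        apply hab
        refine ⟨?_, this⟩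
        rw [this] at e0; linarith
      have hzero : 0 ∈ J → ∀ j ∈ J, j = 0 := by
        intro h0 j hj
        by_contra hj0
        have hj1 : s + 1 ≤ j := (hflat j hj).resolve_left hj0
        have e0 := hJ0 _ h0
        have e1 := hJ0 _ hj
        have e2 := hg (s + 1) hm
        rw [qq_lo (by omega)] at e0 e2
        rw [qq_hi hj1] at e1
        push_cast at *
        have a0 : al = 0 := by linarith
        rw [a0] at e1 e2
        have b0 : 0 ≤ be := by
          by_contra hb
          push Not at hb
          have : be * ((s : ℝ) + 1) < 0 := mul_neg_of_neg_of_pos hb (by positivity)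
          linarith
        have p1 : 0 ≤ μ * ((j : ℝ) - (s + 1)) ^ 2 := by positivity
        have p2 : 0 ≤ be * (j : ℝ) := by positivity
        have p3 : be * (j : ℝ) = 0 := by linarith
        rcases mul_eq_zero.1 p3 with h | h
        · exact hab ⟨a0, h⟩
        · exact hj0 (by exact_mod_cast h)
      suffices h3 : ∀ j ∈ J, ∀ j' ∈ J, j' < j + 2 by
        rcases three_case J h3 with h | ⟨j, hj, h⟩ | ⟨j, hj, hj1, h⟩
        · exact Or.inl h
        · exact Or.inr (Or.inl ⟨j, hJm j hj, hflat j hj, h⟩)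
        · refine Or.inr (Or.inr (Or.inl ⟨j, hJm _ hj1, ?_, h⟩))
          rcases hflat j hj with h0 | h0
          · subst h0
            have := hzero hj _ hj1
            omega
          · exact h0
      intro j hj j' hj'
      by_contra hlt
      push Not at hlt
      have hj1 : s + 1 ≤ j := by
        rcases hflat j hj with h0 | h0
        · subst h0
          have := hzero hj _ hj'
          omega
        · exact h0
      have e1 := hJ0 j hj
      have e2 := hJ0 j' hj'
      have e3 := hg (j + 1) (by have := hJm j' hj'; omega)
      rw [qq_hi (by omega)] at e1 e2 e3
      obtain ⟨u, rfl⟩ := Nat.exists_eq_add_of_le hlt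
      push_cast at *
      have hu : (0 : ℝ) ≤ u := by positivity
      have k1 : 0 ≤ μ * (2 * ((j : ℝ) - (s + 1)) + 1) + be := by linarith
      have k2 : (u + 2) * (μ * (2 * ((j : ℝ) - (s + 1)) + 1) + be + μ * (u + 1)) = 0 := by
        linarith
      have k3 : 0 < μ * ((u : ℝ) + 1) := by positivity
      have k4 : 0 < (u + 2) * (μ * (2 * ((j : ℝ) - (s + 1)) + 1) + be + μ * (u + 1)) := by
        apply mul_pos <;> linarith
      linarith

theorem expo_of_val {r s m : ℕ} (hm : s + 1 ≤ m) {K : Finset (Fin (r + 1))} {J : Finset ℕ}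
    (h : Val r s m K J) : Expo r s m K J := by
  classical
  rcases h with ⟨hK, h⟩ | ⟨⟨k, hk⟩, h⟩ | ⟨hK, h⟩
  · suffices hs : ∃ al be : ℝ, (∀ j ≤ m, 0 ≤ al + be * (j : ℝ)) ∧
        ∀ j, j ∈ J ↔ j ≤ m ∧ al + be * (j : ℝ) = 0 by
      obtain ⟨al, be, h1, h2⟩ := hs
      refine ⟨fun _ => 0, al, be, fun _ => le_rfl, ?_, fun k => by simp [hK], ?_⟩
      · simpa [gg] using h1
      · simpa [gg] using h2
    rcases h with rfl | rfl | rfl | rfl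
    · exact ⟨1, 0, fun j _ => by norm_num, fun j => by simp⟩
    · refine ⟨0, 1, fun j _ => by simp, fun j => ?_⟩
      simp only [Finset.mem_singleton, zero_add, one_mul, Nat.cast_eq_zero]
      omega
    · refine ⟨m, -1, fun j hj => ?_, fun j => ?_⟩
      · have : (j : ℝ) ≤ m := by exact_mod_cast hj
        linarith
      · simp only [Finset.mem_singleton]
        constructor
        · rintro rfl; exact ⟨le_rfl, by ring⟩
        · rintro ⟨_, h⟩
          have : (j : ℝ) = m := by linarith
          exact_mod_cast this
    · refine ⟨0, 0, fun j _ => by simp, fun j => ?_⟩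
      simp
  · set lam : Fin (r + 1) → ℝ := fun k => if k ∈ K then 0 else 1 with hlam
    have hl : ∀ k, 0 ≤ lam k := fun k => by simp only [hlam]; split_ifs <;> norm_num
    have hlK : ∀ k, k ∈ K ↔ lam k = 0 := fun k => by simp [hlam]
    suffices hs : ∃ al be : ℝ, (∀ j ≤ m, 0 ≤ gg r s lam al be j) ∧
        ∀ j, j ∈ J ↔ j ≤ m ∧ gg r s lam al be j = 0 by
      obtain ⟨al, be, h1, h2⟩ := hs
      exact ⟨lam, al, be, hl, h1, hlK, h2⟩
    simp only [gg_eq]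
    have hΛ0 : 0 < ∑ k : Fin r, lam k.castSucc := by
      apply Finset.sum_pos' (fun i _ => hl _)
      exact ⟨k, Finset.mem_univ _, lt_of_le_of_ne (hl _) (fun h => hk ((hlK _).2 h.symm))⟩
    have hμ0 : 0 ≤ lam (Fin.last r) := hl _
    generalize (∑ k : Fin r, lam k.castSucc) = Λ at hΛ0
    generalize lam (Fin.last r) = μ at hμ0
    rcases h with rfl | ⟨j, hj, rfl⟩ | ⟨j, hj, rfl⟩
    · have : ∀ j : ℕ, 0 < Λ * (j : ℝ) ^ 2 + μ * qq s j + 1 + 0 * (j : ℝ) := by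
        intro j
        have := qq_nonneg s j
        positivity
      refine ⟨1, 0, fun j _ => (this j).le, fun j => ?_⟩
      simp only [Finset.notMem_empty, false_iff]
      exact fun h => (this j).ne' h.2
    · obtain ⟨σ, hσ⟩ := qq_tan s j
      refine ⟨Λ * j ^ 2 - μ * qq s j + μ * σ * j, - (2 * Λ * j) - μ * σ, ?_⟩
      have e : ∀ x : ℕ, Λ * (x : ℝ) ^ 2 + μ * qq s x + (Λ * j ^ 2 - μ * qq s j + μ * σ * j)
          + (- (2 * Λ * j) - μ * σ) * x
          = Λ * ((x : ℝ) - j) ^ 2 + μ * (qq s x - (qq s j + σ * ((x : ℝ) - j))) := by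
        intro x; ring
      have hn : ∀ x : ℕ, 0 ≤ μ * (qq s x - (qq s j + σ * ((x : ℝ) - j))) :=
        fun x => mul_nonneg hμ0 (sub_nonneg.2 (hσ x))
      simp only [e, Finset.mem_singleton]
      refine ⟨fun x _ => add_nonneg (by positivity) (hn x), fun x => ⟨?_, ?_⟩⟩
      · rintro rfl; exact ⟨hj, by ring⟩
      · rintro ⟨_, h⟩
        have h1 : 0 ≤ Λ * ((x : ℝ) - j) ^ 2 := by positivity
        have h2 : Λ * ((x : ℝ) - j) ^ 2 = 0 := by have := hn x; linarith
        have h3 : ((x : ℝ) - j) = 0 := by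
          rcases mul_eq_zero.1 h2 with h | h
          · linarith
          · exact pow_eq_zero_iff (two_ne_zero) |>.1 h
        exact_mod_cast sub_eq_zero.1 h3
    · obtain ⟨σ, τ, h1, h2, h3⟩ := qq_sec s j
      refine ⟨Λ * (j * (j + 1)) + μ * τ, - (Λ * (2 * j + 1)) + μ * σ, ?_⟩
      have e : ∀ x : ℕ, Λ * (x : ℝ) ^ 2 + μ * qq s x + (Λ * (j * (j + 1)) + μ * τ)
          + (- (Λ * (2 * j + 1)) + μ * σ) * x
          = Λ * (((x : ℝ) - j) * ((x : ℝ) - j - 1)) + μ * (qq s x + τ + σ * x) := by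
        intro x; ring
      have hn : ∀ x : ℕ, 0 ≤ μ * (qq s x + τ + σ * x) :=
        fun x => mul_nonneg hμ0 (h1 x)
      have hp : ∀ x : ℕ, 0 ≤ Λ * (((x : ℝ) - j) * ((x : ℝ) - j - 1)) :=
        fun x => mul_nonneg hΛ0.le (int_prod x j).1
      simp only [e, Finset.mem_singleton, Finset.mem_insert]
      refine ⟨fun x _ => add_nonneg (hp x) (hn x), fun x => ⟨?_, ?_⟩⟩
      · rintro (rfl | rfl)
        · refine ⟨hj.le, ?_⟩
          rw [h2]; ring
        · refine ⟨hj, ?_⟩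
          rw [h3]; push_cast; ring
      · rintro ⟨_, h⟩
        have h2 : Λ * (((x : ℝ) - j) * ((x : ℝ) - j - 1)) = 0 := by
          have := hn x; have := hp x; linarith
        rcases mul_eq_zero.1 h2 with h | h
        · linarith
        · exact (int_prod x j).2.1 h
  · set lam : Fin (r + 1) → ℝ := fun k => if k ∈ K then 0 else 1 with hlam
    have hl : ∀ k, 0 ≤ lam k := fun k => by simp only [hlam]; split_ifs <;> norm_num
    have hlK : ∀ k, k ∈ K ↔ lam k = 0 := fun k => by simp [hlam]
    have hΛ0 : ∑ k : Fin r, lam k.castSucc = 0 := by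
      apply Finset.sum_eq_zero
      intro k _
      simp [hlam, hK, Fin.castSucc_ne_last]
    have hμ : lam (Fin.last r) = 1 := by simp [hlam, hK]
    suffices hs : ∃ al be : ℝ, (∀ j ≤ m, 0 ≤ qq s j + al + be * (j : ℝ)) ∧
        ∀ j, j ∈ J ↔ j ≤ m ∧ qq s j + al + be * (j : ℝ) = 0 by
      obtain ⟨al, be, h1, h2⟩ := hs
      refine ⟨lam, al, be, hl, ?_, hlK, ?_⟩
      · simpa [gg_eq, hΛ0, hμ] using h1
      · simpa [gg_eq, hΛ0, hμ] using h2
    rcases h with rfl | ⟨j, hj, hj0, rfl⟩ | ⟨j, hj, hj0, rfl⟩ | rfl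
    · refine ⟨1, 0, fun j _ => ?_, fun j => ?_⟩
      · have := qq_nonneg s j; linarith
      · simp only [Finset.notMem_empty, false_iff]
        rintro ⟨_, h⟩
        have := qq_nonneg s j; linarith
    · rcases hj0 with rfl | hj0
      · refine ⟨0, 1, fun j _ => ?_, fun j => ?_⟩
        · have := qq_nonneg s j; positivity
        · simp only [Finset.mem_singleton]
          constructor
          · rintro rfl; exact ⟨hj, by rw [qq_lo (by omega)]; simp⟩
          · rintro ⟨_, h⟩
            have := qq_nonneg s j
            have h2 : (0 : ℝ) ≤ j := by positivity
            have : (j : ℝ) = 0 := by linarith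
            exact_mod_cast this
      · refine ⟨(2 * ((j : ℝ) - (s + 1)) + 1 / 2) * j - ((j : ℝ) - (s + 1)) ^ 2,
          -(2 * ((j : ℝ) - (s + 1)) + 1 / 2), fun x _ => ?_, fun x => ?_⟩
        · have := (qq_strict hj0 x).1; linarith
        · rw [Finset.mem_singleton, ← (qq_strict hj0 x).2]
          constructor
          · intro h
            have hx := (qq_strict hj0 x).2.1 h
            exact ⟨by omega, by linarith⟩
          · rintro ⟨_, h⟩; linarith
    · refine ⟨(2 * ((j : ℝ) - (s + 1)) + 1) * j - ((j : ℝ) - (s + 1)) ^ 2,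
          -(2 * ((j : ℝ) - (s + 1)) + 1), fun x _ => ?_, fun x => ?_⟩
      · have := (qq_sec_hi hj0 x).1; linarith
      · rw [Finset.mem_insert, Finset.mem_singleton, ← (qq_sec_hi hj0 x).2]
        constructor
        · intro h
          have hx := (qq_sec_hi hj0 x).2.1 h
          exact ⟨by omega, by linarith⟩
        · rintro ⟨_, h⟩; linarith
    · refine ⟨0, 0, fun x _ => ?_, fun x => ?_⟩
      · have := qq_nonneg s x; linarith
      · rw [Finset.mem_range]
        constructor
        · intro h
          exact ⟨by omega, by rw [qq_lo (by omega)]; ring⟩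
        · rintro ⟨_, h⟩
          by_contra h3
          rw [qq_hi (by omega)] at h
          have h3' : (s : ℝ) + 1 < x := by
            have : s + 1 < x := by omega
            exact_mod_cast this
          have : 0 < ((x : ℝ) - (s + 1)) ^ 2 := by
            have : 0 < (x : ℝ) - (s + 1) := by linarith
            positivity
          linarith

theorem polyDim_empty {d : ℕ} : polyDim (∅ : Set (Fin d → ℝ)) = 0 := by
  rw [polyDim, AffineSubspace.span_empty, AffineSubspace.direction_bot, finrank_bot]

def LL (r s j : ℕ) : ℝ := 1 + ∑ k, aa r s k j

theorem LL_pos (r s j : ℕ) : 0 < LL r s j := by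
  have : 0 ≤ ∑ k, aa r s k j := Finset.sum_nonneg fun k _ => aa_nonneg r s k j
  unfold LL; linarith

def pt (r s : ℕ) : Fin (r + 1) ⊕ ℕ → Fin (r + 2) → ℝ
  | Sum.inl k => Fin.snoc (α := fun _ => ℝ) (fun k' => if k' = k then 1 else 0) 0
  | Sum.inr j => Fin.snoc (α := fun _ => ℝ) (fun k => aa r s k j / LL r s j) (j / LL r s j)

theorem dot_inl (r s : ℕ) (b : Fin (r + 2) → ℝ) (k : Fin (r + 1)) :
    dotp b (pt r s (Sum.inl k)) = b k.castSucc := by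
  rw [dotp, Fin.sum_univ_castSucc]
  simp [pt]

theorem dot_inr (r s : ℕ) (b : Fin (r + 2) → ℝ) (c : ℝ) (j : ℕ) :
    c - dotp b (pt r s (Sum.inr j)) =
      gg r s (fun k => c - b k.castSucc) c (-b (Fin.last _)) j / LL r s j := by
  have hL := LL_pos r s j
  rw [eq_div_iff hL.ne', dotp, Fin.sum_univ_castSucc]
  simp only [pt, Fin.snoc_castSucc, Fin.snoc_last]
  have h1 : ∑ k : Fin (r + 1), b k.castSucc * (aa r s k j / LL r s j)
      = (∑ k : Fin (r + 1), b k.castSucc * aa r s k j) / LL r s j := by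
    rw [Finset.sum_div]; exact Finset.sum_congr rfl fun k _ => by ring
  have h2 : c * LL r s j = c + ∑ k, c * aa r s k j := by rw [LL, mul_add, Finset.mul_sum]; ring
  rw [h1, gg]
  simp only [sub_mul, Finset.sum_sub_distrib]
  field_simp
  linarith

theorem func (r s : ℕ) (lam : Fin (r + 1) → ℝ) (al be : ℝ) :
    ∃ (b : Fin (r + 2) → ℝ) (c : ℝ), (∀ k, c - dotp b (pt r s (Sum.inl k)) = lam k) ∧
      ∀ j, c - dotp b (pt r s (Sum.inr j)) = gg r s lam al be j / LL r s j := by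
  refine ⟨Fin.snoc (α := fun _ => ℝ) (fun k => al - lam k) (-be), al, fun k => ?_, fun j => ?_⟩
  · rw [dot_inl]; simp
  · rw [dot_inr]; simp

def ix {r : ℕ} (K : Finset (Fin (r + 1))) (J : Finset ℕ) : Finset (Fin (r + 1) ⊕ ℕ) := K.disjSum J

def hul (r s : ℕ) (K : Finset (Fin (r + 1))) (J : Finset ℕ) : Set (Fin (r + 2) → ℝ) :=
  convexHull ℝ (pt r s '' (ix K J : Set (Fin (r + 1) ⊕ ℕ)))

def PP (r s m : ℕ) : Set (Fin (r + 2) → ℝ) := hul r s univ (range (m + 1))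

theorem expo_face {r s m : ℕ} {K : Finset (Fin (r + 1))} {J : Finset ℕ} (h : Expo r s m K J) :
    ∃ (b : Fin (r + 2) → ℝ) (c : ℝ),
      (∀ i ∈ ix (univ : Finset (Fin (r + 1))) (range (m + 1)), dotp b (pt r s i) ≤ c) ∧
      ∀ i, i ∈ ix K J ↔
        i ∈ ix (univ : Finset (Fin (r + 1))) (range (m + 1)) ∧ dotp b (pt r s i) = c := by
  obtain ⟨lam, al, be, hl, hg, hK, hJ⟩ := h
  obtain ⟨b, c, h1, h2⟩ := func r s lam al be
  refine ⟨b, c, ?_, ?_⟩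
  · rintro (k | j) hi
    · have := h1 k; have := hl k; linarith
    · have e := h2 j
      have : j ≤ m := by simpa [ix, Nat.lt_succ_iff] using hi
      have := div_nonneg (hg j this) (LL_pos r s j).le
      linarith
  · rintro (k | j)
    · simp only [ix, Finset.inl_mem_disjSum, hK, Finset.mem_univ, true_and, ← h1]
      exact ⟨fun h => by linarith, fun h => by linarith⟩
    · simp only [ix, Finset.inr_mem_disjSum, hJ, Finset.mem_range, Nat.lt_succ_iff]
      refine and_congr_right fun _ => ?_
      have e := h2 j
      constructor
      · intro h; rw [h, zero_div] at e; linarith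
      · intro h
        rw [h, sub_self] at e
        rcases div_eq_zero_iff.1 e.symm with h | h
        · exact h
        · exact absurd h (LL_pos r s j).ne'

theorem face_expo {r s m : ℕ} (b : Fin (r + 2) → ℝ) (c : ℝ)
    (h : ∀ i ∈ ix (univ : Finset (Fin (r + 1))) (range (m + 1)), dotp b (pt r s i) ≤ c) :
    ∃ K J, Expo r s m K J ∧ ∀ i, i ∈ ix K J ↔
        i ∈ ix (univ : Finset (Fin (r + 1))) (range (m + 1)) ∧ dotp b (pt r s i) = c := by
  classical
  refine ⟨univ.filter fun k => dotp b (pt r s (Sum.inl k)) = c,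
    (range (m + 1)).filter fun j => dotp b (pt r s (Sum.inr j)) = c,
    ⟨fun k => c - b k.castSucc, c, -b (Fin.last _), fun k => ?_, fun j hj => ?_, fun k => ?_,
      fun j => ?_⟩, ?_⟩
  · have := h (Sum.inl k) (by simp [ix])
    rw [dot_inl] at this
    linarith
  · have := h (Sum.inr j) (by simp [ix]; omega)
    have e := dot_inr r s b c j
    rw [eq_div_iff (LL_pos r s j).ne'] at e
    rw [← e]
    exact mul_nonneg (by linarith) (LL_pos r s j).le
  · simp only [Finset.mem_filter, Finset.mem_univ, true_and, dot_inl]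
    exact ⟨fun h => by linarith, fun h => by linarith⟩
  · simp only [Finset.mem_filter, Finset.mem_range, Nat.lt_succ_iff]
    refine and_congr_right fun _ => ?_
    have e := dot_inr r s b c j
    rw [eq_div_iff (LL_pos r s j).ne'] at e
    rw [← e]
    constructor
    · intro h; rw [h]; ring
    · intro h
      rcases mul_eq_zero.1 h with h | h
      · linarith
      · exact absurd h (LL_pos r s j).ne'
  · rintro (k | j) <;> simp [ix]

theorem hul_nonempty {r s : ℕ} {K : Finset (Fin (r + 1))} {J : Finset ℕ}
    (h : (ix K J).Nonempty) : (hul r s K J).Nonempty := by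
  rw [hul, convexHull_nonempty_iff]
  exact (Set.image_nonempty.2 (by exact_mod_cast h))

theorem isFace_iff (r s m : ℕ) (F : Set (Fin (r + 2) → ℝ)) :
    IsFaceOf (PP r s m) F ↔ ∃ K J, Expo r s m K J ∧ F = hul r s K J := by
  have key : ∀ b c, (∀ x ∈ PP r s m, dotp b x ≤ c) →
      ∃ K J, Expo r s m K J ∧ {x ∈ PP r s m | dotp b x = c} = hul r s K J := by
    intro b c h
    have h' : ∀ i ∈ ix (univ : Finset (Fin (r + 1))) (range (m + 1)), dotp b (pt r s i) ≤ c :=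
      fun i hi => h _ (subset_convexHull ℝ _ ⟨i, hi, rfl⟩)
    obtain ⟨K, J, h1, h2⟩ := face_expo b c h'
    exact ⟨K, J, h1, face_hull (pt r s) _ _ b c h' h2⟩
  have d0 : ∀ x : Fin (r + 2) → ℝ, dotp 0 x = 0 := fun x => by simp [dotp]
  constructor
  · rintro (rfl | rfl | ⟨b, c, _, h, rfl⟩)
    · obtain ⟨K, J, h1, h2⟩ := key 0 1 (fun x _ => by rw [d0]; norm_num)
      refine ⟨K, J, h1, ?_⟩
      rw [← h2]; ext x; simp [d0]
    · obtain ⟨K, J, h1, h2⟩ := key 0 0 (fun x _ => by rw [d0])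
      refine ⟨K, J, h1, ?_⟩
      rw [← h2]; ext x; simp [d0]
    · exact key b c h
  · rintro ⟨K, J, h, rfl⟩
    obtain ⟨b, c, h1, h2⟩ := expo_face h
    have h3 := face_hull (pt r s) _ _ b c h1 h2
    have h4 := hull_le (pt r s) _ b c h1
    by_cases hb : b = 0
    · subst hb
      by_cases hc : c = 0
      · right; left
        rw [hul, ← h3]; ext x; simp [d0, hc, PP, hul]
      · left
        rw [hul, ← h3]; ext x; simp [d0, Ne.symm hc]
    · right; right
      exact ⟨b, c, hb, h4, h3.symm⟩

theorem expo_mem {r s m : ℕ} {K : Finset (Fin (r + 1))} {J : Finset ℕ} (h : Expo r s m K J)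
    (i) (hi : i ∈ ix (univ : Finset (Fin (r + 1))) (range (m + 1))) :
    pt r s i ∈ hul r s K J ↔ i ∈ ix K J := by
  obtain ⟨b, c, h1, h2⟩ := expo_face h
  have h3 := face_hull (pt r s) _ _ b c h1 h2
  constructor
  · intro hx
    rw [hul, ← h3] at hx
    exact (h2 i).2 ⟨hi, hx.2⟩
  · intro hx
    exact subset_convexHull ℝ _ ⟨i, hx, rfl⟩

theorem expo_inj {r s m : ℕ} {K K' : Finset (Fin (r + 1))} {J J' : Finset ℕ}
    (h : Expo r s m K J) (h' : Expo r s m K' J') (he : hul r s K J = hul r s K' J') :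
    K = K' ∧ J = J' := by
  constructor
  · ext k
    have := expo_mem h (Sum.inl k) (by simp [ix])
    rw [he, expo_mem h' (Sum.inl k) (by simp [ix])] at this
    simpa [ix] using this.symm
  · have hsub : ∀ {K J}, Expo r s m K J → ∀ j ∈ J, j ≤ m := by
      rintro K J ⟨_, _, _, _, _, _, hJ⟩ j hj
      exact ((hJ j).1 hj).1
    have hh : ∀ j ≤ m, j ∈ J ↔ j ∈ J' := by
      intro j hj
      have hi : Sum.inr j ∈ ix (univ : Finset (Fin (r + 1))) (range (m + 1)) := by
        simp [ix]; omega
      have := expo_mem h (Sum.inr j) hi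
      rw [he, expo_mem h' (Sum.inr j) hi] at this
      simpa [ix] using this.symm
    ext j
    exact ⟨fun hj => (hh j (hsub h j hj)).1 hj, fun hj => (hh j (hsub h' j hj)).2 hj⟩

theorem interp (J : Finset ℕ) (hJ : J.card ≤ 2) (f : ℕ → ℝ) :
    ∃ al be : ℝ, ∀ j ∈ J, f j + al + be * j = 0 := by
  have : J.card = 0 ∨ J.card = 1 ∨ J.card = 2 := by omega
  rcases this with h | h | h
  · rw [Finset.card_eq_zero] at h
    subst h; exact ⟨0, 0, by simp⟩
  · obtain ⟨a, rfl⟩ := Finset.card_eq_one.1 h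
    exact ⟨-f a, 0, by simp⟩
  · obtain ⟨a, b, hab, rfl⟩ := Finset.card_eq_two.1 h
    have hne : (a : ℝ) - b ≠ 0 := sub_ne_zero.2 (by exact_mod_cast hab)
    refine ⟨-f a + (f a - f b) / (a - b) * a, -((f a - f b) / (a - b)), ?_⟩
    intro j hj
    simp only [Finset.mem_insert, Finset.mem_singleton] at hj
    rcases hj with rfl | rfl
    · ring
    · field_simp; ring

theorem dim_small {r s i : ℕ} {K : Finset (Fin (r + 1))} {J : Finset ℕ} (hJ : J.card ≤ 2)
    (hc : K.card + J.card = i + 1) : polyDim (hul r s K J) = i := by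
  classical
  apply dim_indep
  · rintro (k | j) hi
    · obtain ⟨al, be, h⟩ := interp J hJ (fun j => aa r s k j)
      obtain ⟨b, c, h1, h2⟩ := func r s (fun k' => if k' = k then 1 else 0) al be
      refine ⟨b, c, ?_, ?_⟩
      · have := h1 k
        simp only [if_true] at this
        intro h; rw [h] at this; norm_num at this
      · rintro (k' | j') hi' hne
        · have := h1 k'
          rw [if_neg (fun h => hne (by rw [h]))] at this
          linarith
        · have := h2 j'
          have h3 := h j' (by simpa [ix] using hi')
          have h4 : gg r s (fun k' => if k' = k then 1 else 0) al be j' = 0 := by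
            simp only [gg]; simpa using h3
          rw [h4, zero_div] at this
          linarith
    · obtain ⟨al, be, h⟩ := interp J hJ (fun j' => if j' = j then 1 else 0)
      obtain ⟨b, c, h1, h2⟩ := func r s (fun _ => 0) al be
      have hL := LL_pos r s j
      refine ⟨b, c, ?_, ?_⟩
      · have := h2 j
        have h3 := h j (by simpa [ix] using hi)
        have h4 : gg r s (fun k' => 0) al be j = -1 := by
          simp [gg] at h3 ⊢; linarith
        intro h
        rw [h4, h, sub_self, eq_div_iff hL.ne'] at this
        norm_num at this
      · rintro (k' | j') hi' hne
        · have := h1 k'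
          linarith
        · have := h2 j'
          have h3 := h j' (by simpa [ix] using hi')
          rw [if_neg (fun h => hne (by rw [h]))] at h3
          have h4 : gg r s (fun k' => 0) al be j' = 0 := by
            simp only [gg]; simpa using h3
          rw [h4, zero_div] at this
          linarith
  · rw [ix, Finset.card_disjSum, hc]

theorem hul_mono {r s : ℕ} {K K' : Finset (Fin (r + 1))} {J J' : Finset ℕ}
    (h : K ⊆ K') (h' : J ⊆ J') : polyDim (hul r s K J) ≤ polyDim (hul r s K' J') := by
  rw [hul, hul, polyDim_hull, polyDim_hull]
  apply Submodule.finrank_mono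
  apply vectorSpan_mono
  apply Set.image_mono
  exact_mod_cast Finset.disjSum_mono h h'

theorem dim_full {r s m : ℕ} (hm : 1 ≤ m) : polyDim (PP r s m) = r + 2 := by
  apply le_antisymm
  · rw [polyDim]
    refine (Submodule.finrank_le _).trans ?_
    simp
  · refine (dim_small (r := r) (s := s) (K := univ) (J := {0, 1}) (by simp)
      (i := r + 2) (by simp)).ge.trans ?_
    apply hul_mono (Finset.Subset.refl _)
    intro j hj
    simp only [Finset.mem_insert, Finset.mem_singleton] at hj
    rw [Finset.mem_range]; omega

theorem dim_lt {d : ℕ} {X : Set (Fin d → ℝ)} (b : Fin d → ℝ) (c : ℝ) (hX : ∀ x ∈ X, dotp b x = c)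
    {x0 : Fin d → ℝ} (hx0 : x0 ∈ X) (y : Fin d → ℝ) (hy : dotp b y ≠ c) :
    polyDim (convexHull ℝ X) < d := by
  let ℓ : (Fin d → ℝ) →ₗ[ℝ] ℝ :=
    { toFun := dotp b
      map_add' := fun x y => by simpa using dotp_add b x y 1 1
      map_smul' := fun t x => by simpa using dotp_add b x 0 t 0 }
  have hsub : ∀ x y, dotp b (x - y) = dotp b x - dotp b y := fun x y => ℓ.map_sub x y
  rw [polyDim_hull]
  have hle : vectorSpan ℝ X ≤ LinearMap.ker ℓ := by
    rw [vectorSpan, Submodule.span_le]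
    rintro _ ⟨x, hx, z, hz, rfl⟩
    change dotp b (x - z) = 0
    rw [hsub, hX x hx, hX z hz, sub_self]
  have hne : vectorSpan ℝ X < ⊤ := by
    rw [lt_top_iff_ne_top]
    intro h
    have h1 : y - x0 ∈ LinearMap.ker ℓ := hle (h ▸ Submodule.mem_top)
    have h2 : dotp b (y - x0) = 0 := h1
    rw [hsub, hX x0 hx0] at h2
    exact hy (by linarith)
  simpa using Submodule.finrank_lt hne.ne

theorem dim_big {r s m : ℕ} (hm : s + 1 ≤ m) :
    polyDim (hul r s (univ.erase (Fin.last r)) (range (s + 2))) = r + 1 := by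
  apply le_antisymm
  · have hV : Val r s m (univ.erase (Fin.last r)) (range (s + 2)) :=
      Or.inr (Or.inr ⟨rfl, Or.inr (Or.inr (Or.inr rfl))⟩)
    obtain ⟨b, c, h1, h2⟩ := expo_face (expo_of_val hm hV)
    apply Nat.le_of_lt_succ
    refine dim_lt b c ?_ (x0 := pt r s (Sum.inr 0)) ⟨Sum.inr 0, ?_, rfl⟩ (pt r s (Sum.inl (Fin.last r))) ?_
    · rintro _ ⟨i, hi, rfl⟩
      exact ((h2 i).1 hi).2
    · simp [ix]
    · intro h
      have := (h2 (Sum.inl (Fin.last r))).2 ⟨by simp [ix], h⟩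
      simp [ix] at this
  · refine (dim_small (r := r) (s := s) (K := univ.erase (Fin.last r)) (J := {0, 1}) (by simp)
      (i := r + 1) (by simp)).ge.trans ?_
    apply hul_mono (Finset.Subset.refl _)
    intro j hj
    simp only [Finset.mem_insert, Finset.mem_singleton] at hj
    rw [Finset.mem_range]; omega

theorem fVec_eq {r s m i : ℕ} (hm : s + 1 ≤ m) (hi : 1 ≤ i)
    (T : Finset (Finset (Fin (r + 1)) × Finset ℕ))
    (hT : ∀ K J, (K, J) ∈ T ↔ Val r s m K J ∧ polyDim (hul r s K J) = i) :
    fVec (PP r s m) i = T.card := by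
  have hE : ∀ K J, Val r s m K J → Expo r s m K J := fun K J h => expo_of_val hm h
  have : {F : Set (Fin (r + 2) → ℝ) | IsFaceOf (PP r s m) F ∧ F.Nonempty ∧ polyDim F = i}
      = (fun p : Finset (Fin (r + 1)) × Finset ℕ => hul r s p.1 p.2) '' (T : Set _) := by
    ext F
    simp only [Set.mem_ofPred_eq, isFace_iff, Set.mem_image, Finset.mem_coe, Prod.exists, hT]
    constructor
    · rintro ⟨⟨K, J, h1, rfl⟩, _, h2⟩
      exact ⟨K, J, ⟨val_of_expo hm h1, h2⟩, rfl⟩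
    · rintro ⟨K, J, ⟨h1, h2⟩, rfl⟩
      refine ⟨⟨K, J, hE _ _ h1, rfl⟩, ?_, h2⟩
      by_contra hne
      rw [Set.not_nonempty_iff_eq_empty] at hne
      rw [hne, polyDim_empty] at h2
      omega
  rw [fVec, this, Set.InjOn.ncard_image, Set.ncard_coe_finset]
  rintro ⟨K, J⟩ h ⟨K', J'⟩ h' he
  have h1 := expo_inj (hE _ _ ((hT _ _).1 h).1) (hE _ _ ((hT _ _).1 h').1) he
  rw [h1.1, h1.2]

theorem single_expo {r s m : ℕ} (hr : 1 ≤ r) (hm : s + 1 ≤ m) (i : Fin (r + 1) ⊕ ℕ)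
    (hi : i ∈ ix (univ : Finset (Fin (r + 1))) (range (m + 1))) :
    ∃ (b : Fin (r + 2) → ℝ) (c : ℝ),
      (∀ j ∈ ix (univ : Finset (Fin (r + 1))) (range (m + 1)), dotp b (pt r s j) ≤ c) ∧
      ∀ j ∈ ix (univ : Finset (Fin (r + 1))) (range (m + 1)), dotp b (pt r s j) = c ↔ j = i := by
  classical
  suffices h : ∃ K J, Expo r s m K J ∧ ∀ j, j ∈ ix K J ↔ j = i by
    obtain ⟨K, J, h1, h2⟩ := h
    obtain ⟨b, c, h3, h4⟩ := expo_face h1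
    refine ⟨b, c, h3, fun j hj => ?_⟩
    rw [← h2, h4]
    exact ⟨fun h => ⟨hj, h⟩, fun h => h.2⟩
  rcases i with k | j
  · refine ⟨{k}, ∅, ⟨fun k' => if k' = k then 0 else 1, 1, 0, fun k' => ?_, ?_, fun k' => ?_, ?_⟩, ?_⟩
    · dsimp only; split_ifs <;> norm_num
    all_goals try
      have hp : ∀ j, 0 < gg r s (fun k' => if k' = k then 0 else 1) 1 0 j := by
        intro j
        have : 0 ≤ ∑ k', (if k' = k then (0 : ℝ) else 1) * aa r s k' j :=
          Finset.sum_nonneg fun k' _ =>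
            mul_nonneg (by split_ifs <;> norm_num) (aa_nonneg r s k' j)
        unfold gg; linarith
    · exact fun j _ => (hp j).le
    · simp
    · intro j
      simp only [Finset.notMem_empty, false_iff]
      exact fun h => (hp j).ne' h.2
    · rintro (k' | j) <;> simp [ix]
  · have hj : j ≤ m := by simpa [ix, Nat.lt_succ_iff] using hi
    refine ⟨∅, {j}, expo_of_val hm (Or.inr (Or.inl ⟨⟨⟨0, hr⟩, by simp⟩, Or.inr (Or.inl ⟨j, hj, rfl⟩)⟩)), ?_⟩
    rintro (k' | j) <;> simp [ix]

theorem verts_card {r s m : ℕ} (hr : 1 ≤ r) (hm : s + 1 ≤ m) (K : Finset (Fin (r + 1)))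
    (J : Finset ℕ) (hJ : J ⊆ range (m + 1)) :
    (verts (hul r s K J)).ncard = K.card + J.card := by
  classical
  have hs : ix K J ⊆ ix (univ : Finset (Fin (r + 1))) (range (m + 1)) :=
    Finset.disjSum_mono (Finset.subset_univ _) hJ
  rw [hul, verts_hull]
  · rw [Set.InjOn.ncard_image, Set.ncard_coe_finset, ix, Finset.card_disjSum]
    intro i hi j hj he
    obtain ⟨b, c, h1, h2⟩ := single_expo (s := s) hr hm i (hs hi)
    have h3 := (h2 i (hs hi)).2 rfl
    rw [he] at h3
    exact ((h2 j (hs hj)).1 h3).symm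
  · intro i hi
    obtain ⟨b, c, h1, h2⟩ := single_expo (s := s) hr hm i (hs hi)
    exact ⟨b, c, fun j hj => h1 j (hs hj), fun j hj => h2 j (hs hj)⟩

theorem dim_of_val {r s m i : ℕ} (hm : s + 1 ≤ m) (hi : 1 ≤ i) (hi' : i ≤ r + 1)
    {K : Finset (Fin (r + 1))} {J : Finset ℕ} (h : Val r s m K J)
    (hd : polyDim (hul r s K J) = i) :
    (J.card ≤ 2 ∧ K.card + J.card = i + 1) ∨
      (i = r + 1 ∧ K = univ.erase (Fin.last r) ∧ J = range (s + 2)) := by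
  have small : J.card ≤ 2 → (J.card ≤ 2 ∧ K.card + J.card = i + 1) := by
    intro hJ
    refine ⟨hJ, ?_⟩
    rcases Nat.eq_zero_or_pos (K.card + J.card) with h0 | h0
    · exfalso
      have h1 : K = ∅ := Finset.card_eq_zero.1 (by omega)
      have h2 : J = ∅ := Finset.card_eq_zero.1 (by omega)
      subst h1 h2
      have he : hul r s ∅ ∅ = ∅ := by simp [hul, ix]
      rw [he, polyDim_empty] at hd
      omega
    · obtain ⟨u, hu⟩ : ∃ u, K.card + J.card = u + 1 := ⟨K.card + J.card - 1, by omega⟩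
      rw [dim_small hJ hu] at hd
      omega
  have c2 : ∀ j : ℕ, ({j, j + 1} : Finset ℕ).card ≤ 2 := fun j => Finset.card_le_two
  rcases h with ⟨hK, h | h | h | h⟩ | ⟨_, h | ⟨j, _, h⟩ | ⟨j, _, h⟩⟩ |
      ⟨hK, h | ⟨j, _, _, h⟩ | ⟨j, _, _, h⟩ | h⟩
  · exact Or.inl (small (by simp [h]))
  · exact Or.inl (small (by simp [h]))
  · exact Or.inl (small (by simp [h]))
  · exfalso
    subst hK h
    have := dim_full (r := r) (s := s) (m := m) (by omega)
    rw [PP, hd] at this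
    omega
  · exact Or.inl (small (by simp [h]))
  · exact Or.inl (small (by simp [h]))
  · exact Or.inl (small (by rw [h]; exact c2 j))
  · exact Or.inl (small (by simp [h]))
  · exact Or.inl (small (by simp [h]))
  · exact Or.inl (small (by rw [h]; exact c2 j))
  · right
    subst hK h
    rw [dim_big hm] at hd
    exact ⟨hd.symm, rfl, rfl⟩

theorem K_tri {r : ℕ} (K : Finset (Fin (r + 1))) :
    K = univ ∨ (∃ k : Fin r, k.castSucc ∉ K) ∨ K = univ.erase (Fin.last r) := by
  by_cases hc : ∃ k : Fin r, k.castSucc ∉ K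
  · exact Or.inr (Or.inl hc)
  push Not at hc
  by_cases hl : Fin.last r ∈ K
  · left
    exact Finset.eq_univ_iff_forall.2 (fun k => Fin.lastCases hl hc k)
  · right; right
    ext k
    simp only [Finset.mem_erase, Finset.mem_univ, and_true]
    refine Fin.lastCases ?_ (fun i => ?_) k
    · simp [hl]
    · simp [hc i, Fin.castSucc_ne_last]

theorem card_er (r : ℕ) : (univ.erase (Fin.last r)).card = r := by simp

theorem pair_card (j : ℕ) : ({j, j + 1} : Finset ℕ).card = 2 := Finset.card_pair (by omega)

theorem er_ne (r : ℕ) : univ.erase (Fin.last r) ≠ univ := by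
  intro h
  have := congrArg Finset.card h
  rw [card_er] at this
  simp at this

theorem char_val {r s m i : ℕ} (hr : 1 ≤ r) (hm : s + 1 ≤ m) (hi : 1 ≤ i) (hi' : i ≤ r + 1)
    (K : Finset (Fin (r + 1))) (J : Finset ℕ) :
    (Val r s m K J ∧ polyDim (hul r s K J) = i) ↔
      ((J = ∅ ∧ K.card = i + 1) ∨
      (∃ j ≤ m, J = {j} ∧ K.card = i ∧ (K = univ → j = 0 ∨ j = m) ∧
        (K = univ.erase (Fin.last r) → j = 0 ∨ s + 1 ≤ j)) ∨
      (∃ j < m, J = {j, j + 1} ∧ K.card + 1 = i ∧ (K = univ.erase (Fin.last r) → s + 1 ≤ j)) ∨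
      (i = r + 1 ∧ K = univ.erase (Fin.last r) ∧ J = range (s + 2))) := by
  have er_mem : ∀ k : Fin r, k.castSucc ∈ univ.erase (Fin.last r) := fun k => by
    simp [Fin.castSucc_ne_last]
  have er1 := er_ne r
  have cer := card_er r
  constructor
  · rintro ⟨hV, hd⟩
    rcases dim_of_val hm hi hi' hV hd with ⟨hJ, hc⟩ | h
    swap
    · exact Or.inr (Or.inr (Or.inr h))
    rcases hV with ⟨hK, h | h | h | h⟩ | ⟨⟨k, hk⟩, h | ⟨j, hj, h⟩ | ⟨j, hj, h⟩⟩ |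
      ⟨hK, h | ⟨j, hj, hj', h⟩ | ⟨j, hj, hj', h⟩ | h⟩
    · left; subst h; exact ⟨rfl, by simpa using hc⟩
    · right; left; subst h
      exact ⟨0, by omega, rfl, by simpa using hc, fun _ => Or.inl rfl, fun _ => Or.inl rfl⟩
    · right; left; subst h
      exact ⟨m, by omega, rfl, by simpa using hc, fun _ => Or.inr rfl, fun _ => Or.inr hm⟩
    · exfalso
      subst hK h
      simp at hc hJ
      omega
    · left; subst h; exact ⟨rfl, by simpa using hc⟩
    · right; left; subst h
      refine ⟨j, hj, rfl, by simpa using hc, ?_, ?_⟩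
      · rintro rfl; simp at hk
      · rintro rfl; exact absurd (er_mem k) hk
    · right; right; left; subst h
      rw [pair_card] at hc
      refine ⟨j, hj, rfl, by omega, ?_⟩
      rintro rfl; exact absurd (er_mem k) hk
    · left; subst h; exact ⟨rfl, by simpa using hc⟩
    · right; left; subst h
      exact ⟨j, hj, rfl, by simpa using hc, fun h => absurd (hK.symm.trans h) er1, fun _ => hj'⟩
    · right; right; left; subst h
      rw [pair_card] at hc
      exact ⟨j, hj, rfl, by omega, fun _ => hj'⟩
    · right; right; right
      refine ⟨?_, hK, h⟩
      subst hK h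
      rw [cer, Finset.card_range] at hc
      rw [Finset.card_range] at hJ
      omega
  · rintro (⟨rfl, h⟩ | ⟨j, hj, rfl, h, h1, h2⟩ | ⟨j, hj, rfl, h, h2⟩ | ⟨rfl, rfl, rfl⟩)
    · refine ⟨?_, dim_small (by simp) (by simpa using h)⟩
      rcases K_tri K with hK | hK | hK
      · exact Or.inl ⟨hK, Or.inl rfl⟩
      · exact Or.inr (Or.inl ⟨hK, Or.inl rfl⟩)
      · exact Or.inr (Or.inr ⟨hK, Or.inl rfl⟩)
    · refine ⟨?_, dim_small (by simp) (by simpa using h)⟩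
      rcases K_tri K with hK | hK | hK
      · rcases h1 hK with rfl | rfl
        · exact Or.inl ⟨hK, Or.inr (Or.inl rfl)⟩
        · exact Or.inl ⟨hK, Or.inr (Or.inr (Or.inl rfl))⟩
      · exact Or.inr (Or.inl ⟨hK, Or.inr (Or.inl ⟨j, hj, rfl⟩)⟩)
      · exact Or.inr (Or.inr ⟨hK, Or.inr (Or.inl ⟨j, hj, h2 hK, rfl⟩)⟩)
    · refine ⟨?_, dim_small (pair_card j).le (by rw [pair_card]; omega)⟩
      rcases K_tri K with hK | hK | hK
      · subst hK
        simp at h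
        omega
      · exact Or.inr (Or.inl ⟨hK, Or.inr (Or.inr ⟨j, hj, rfl⟩)⟩)
      · exact Or.inr (Or.inr ⟨hK, Or.inr (Or.inr (Or.inl ⟨j, hj, h2 hK, rfl⟩))⟩)
    · exact ⟨Or.inr (Or.inr ⟨rfl, Or.inr (Or.inr (Or.inr rfl))⟩), dim_big hm⟩

def sg (j : ℕ) : Finset ℕ := {j}
def pr (j : ℕ) : Finset ℕ := {j, j + 1}

theorem sg_inj : Function.Injective sg := fun a b h => Finset.singleton_injective h

theorem pr_inj : Function.Injective pr := by
  intro a b h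
  have h1 : a ∈ pr b := h ▸ (by simp [pr])
  have h2 : b ∈ pr a := h ▸ (by simp [pr])
  simp [pr] at h1 h2
  omega

def T0 (r i : ℕ) : Finset (Finset (Fin (r + 1)) × Finset ℕ) := powersetCard (i + 1) univ ×ˢ {∅}
def T1 (r m i : ℕ) : Finset (Finset (Fin (r + 1)) × Finset ℕ) :=
  powersetCard i univ ×ˢ (range (m + 1)).image sg
def T2 (r m i : ℕ) : Finset (Finset (Fin (r + 1)) × Finset ℕ) :=
  powersetCard (i - 1) univ ×ˢ (range m).image pr

theorem mem_T0 {r i : ℕ} {K : Finset (Fin (r + 1))} {J : Finset ℕ} :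
    (K, J) ∈ T0 r i ↔ K.card = i + 1 ∧ J = ∅ := by
  simp [T0, Finset.mem_powersetCard]
  exact fun _ => eq_comm

theorem mem_T1 {r m i : ℕ} {K : Finset (Fin (r + 1))} {J : Finset ℕ} :
    (K, J) ∈ T1 r m i ↔ K.card = i ∧ ∃ j ≤ m, J = {j} := by
  simp [T1, Finset.mem_powersetCard, sg, eq_comm]

theorem mem_T2 {r m i : ℕ} {K : Finset (Fin (r + 1))} {J : Finset ℕ} :
    (K, J) ∈ T2 r m i ↔ K.card = i - 1 ∧ ∃ j < m, J = {j, j + 1} := by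
  simp [T2, Finset.mem_powersetCard, pr, eq_comm]

theorem card_T2 (r m i : ℕ) : (T2 r m i).card = (r + 1).choose (i - 1) * m := by
  rw [T2, Finset.card_product, Finset.card_powersetCard, Finset.card_image_of_injective _ pr_inj]
  simp

theorem card_TT (r m i : ℕ) : (T0 r i ∪ T1 r m i ∪ T2 r m i).card =
    (r + 1).choose (i + 1) + (r + 1).choose i * (m + 1) + (r + 1).choose (i - 1) * m := by
  rw [Finset.card_union_of_disjoint, Finset.card_union_of_disjoint, card_T2, T0, T1,
    Finset.card_product, Finset.card_product, Finset.card_powersetCard, Finset.card_powersetCard,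
    Finset.card_image_of_injective _ sg_inj]
  · simp
  · rw [Finset.disjoint_left]
    rintro ⟨K, J⟩ h1 h2
    rw [mem_T0] at h1
    obtain ⟨_, j, _, h⟩ := mem_T1.1 h2
    have := congrArg Finset.card (h1.2.symm.trans h)
    simp at this
  · rw [Finset.disjoint_left]
    rintro ⟨K, J⟩ h1 h2
    obtain ⟨_, j, _, h⟩ := mem_T2.1 h2
    rw [Finset.mem_union, mem_T0, mem_T1] at h1
    rcases h1 with ⟨_, h1⟩ | ⟨_, j', _, h1⟩
    · have := congrArg Finset.card (h1.symm.trans h)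
      rw [pair_card] at this
      simp at this
    · have := congrArg Finset.card (h1.symm.trans h)
      rw [pair_card] at this
      simp at this

theorem fVec_lo {r s m i : ℕ} (hr : 1 ≤ r) (hm : s + 1 ≤ m) (hi : 1 ≤ i) (hi' : i < r) :
    fVec (PP r s m) i =
      (r + 1).choose (i + 1) + (r + 1).choose i * (m + 1) + (r + 1).choose (i - 1) * m := by
  rw [← card_TT]
  apply fVec_eq hm hi
  intro K J
  rw [char_val hr hm hi (by omega), Finset.mem_union, Finset.mem_union, mem_T0, mem_T1, mem_T2]
  have hu : (univ : Finset (Fin (r + 1))).card = r + 1 := by simp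
  have cer := card_er r
  constructor
  · rintro ((⟨h1, h2⟩ | ⟨h1, j, hj, h2⟩) | ⟨h1, j, hj, h2⟩)
    · exact Or.inl ⟨h2, h1⟩
    · refine Or.inr (Or.inl ⟨j, hj, h2, h1, ?_, ?_⟩)
      · rintro rfl; omega
      · rintro rfl; omega
    · refine Or.inr (Or.inr (Or.inl ⟨j, hj, h2, by omega, ?_⟩))
      rintro rfl; omega
  · rintro (⟨h1, h2⟩ | ⟨j, hj, h1, h2, _⟩ | ⟨j, hj, h1, h2, _⟩ | ⟨h, _⟩)
    · exact Or.inl (Or.inl ⟨h2, h1⟩)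
    · exact Or.inl (Or.inr ⟨h2, j, hj, h1⟩)
    · exact Or.inr ⟨by omega, j, hj, h1⟩
    · omega

theorem fVec_mid {r s m : ℕ} (hr : 1 ≤ r) (hm : s + 1 ≤ m) :
    fVec (PP r s m) r + s =
      (r + 1).choose (r + 1) + (r + 1).choose r * (m + 1) + (r + 1).choose (r - 1) * m := by
  classical
  have hu : (univ : Finset (Fin (r + 1))).card = r + 1 := by simp
  have cer := card_er r
  let R : Finset (Finset (Fin (r + 1)) × Finset ℕ) :=
    {univ.erase (Fin.last r)} ×ˢ (Icc 1 s).image sg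
  have hR : ∀ K J, (K, J) ∈ R ↔ K = univ.erase (Fin.last r) ∧ ∃ j, 1 ≤ j ∧ j ≤ s ∧ J = {j} := by
    intro K J
    simp [R, sg, eq_comm, and_assoc]
    exact and_comm
  have hRc : R.card = s := by
    simp only [R, Finset.card_product, Finset.card_image_of_injective _ sg_inj]
    simp
  have hsub : R ⊆ T0 r r ∪ T1 r m r ∪ T2 r m r := by
    rintro ⟨K, J⟩ h
    obtain ⟨h1, j, hj, hj', h2⟩ := (hR K J).1 h
    rw [Finset.mem_union, Finset.mem_union, mem_T1]
    refine Or.inl (Or.inr ⟨by rw [h1, cer], j, by omega, h2⟩)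
  have key : fVec (PP r s m) r = ((T0 r r ∪ T1 r m r ∪ T2 r m r) \ R).card := by
    apply fVec_eq hm hr
    intro K J
    rw [char_val hr hm hr (by omega), Finset.mem_sdiff, Finset.mem_union, Finset.mem_union,
      mem_T0, mem_T1, mem_T2, hR]
    constructor
    · rintro ⟨(⟨h1, h2⟩ | ⟨h1, j, hj, h2⟩) | ⟨h1, j, hj, h2⟩, hn⟩
      · exact Or.inl ⟨h2, h1⟩
      · refine Or.inr (Or.inl ⟨j, hj, h2, h1, ?_, ?_⟩)
        · rintro rfl; omega
        · intro h
          by_contra hc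
          push Not at hc
          exact hn ⟨h, j, by omega, by omega, h2⟩
      · refine Or.inr (Or.inr (Or.inl ⟨j, hj, h2, by omega, ?_⟩))
        rintro rfl; omega
    · rintro (⟨h1, h2⟩ | ⟨j, hj, h1, h2, h3, h4⟩ | ⟨j, hj, h1, h2, _⟩ | ⟨h, _⟩)
      · refine ⟨Or.inl (Or.inl ⟨h2, h1⟩), ?_⟩
        rintro ⟨rfl, _⟩
        omega
      · refine ⟨Or.inl (Or.inr ⟨h2, j, hj, h1⟩), ?_⟩
        rintro ⟨h5, j', h6, h7, h8⟩
        have : j = j' := Finset.singleton_injective (h1.symm.trans h8)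
        have := h4 h5
        omega
      · refine ⟨Or.inr ⟨by omega, j, hj, h1⟩, ?_⟩
        rintro ⟨rfl, _⟩
        omega
      · omega
  rw [key, ← card_TT, ← Finset.card_sdiff_add_card_eq_card hsub, hRc]

theorem fVec_hi {r s m : ℕ} (hr : 1 ≤ r) (hm : s + 1 ≤ m) :
    fVec (PP r s m) (r + 1) + s = (r + 1) * m + 2 := by
  classical
  have hu : (univ : Finset (Fin (r + 1))).card = r + 1 := by simp
  have cer := card_er r
  let R : Finset (Finset (Fin (r + 1)) × Finset ℕ) :=
    {univ.erase (Fin.last r)} ×ˢ (range (s + 1)).image pr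
  have hR : ∀ K J, (K, J) ∈ R ↔ K = univ.erase (Fin.last r) ∧ ∃ j ≤ s, J = {j, j + 1} := by
    intro K J
    simp [R, pr, eq_comm]
    exact and_comm
  have hRc : R.card = s + 1 := by
    simp only [R, Finset.card_product, Finset.card_image_of_injective _ pr_inj]
    simp
  have hsub : R ⊆ T2 r m (r + 1) := by
    rintro ⟨K, J⟩ h
    obtain ⟨h1, j, hj, h2⟩ := (hR K J).1 h
    rw [mem_T2]
    refine ⟨by rw [h1, cer]; omega, j, by omega, h2⟩
  let E : Finset (Finset (Fin (r + 1)) × Finset ℕ) := {univ} ×ˢ {{0}, {m}}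
  have hE : ∀ K J, (K, J) ∈ E ↔ K = univ ∧ (J = {0} ∨ J = {m}) := by
    intro K J; simp [E]; tauto
  have hEc : E.card = 2 := by
    simp only [E, Finset.card_product, Finset.card_singleton, one_mul]
    apply Finset.card_pair
    intro h
    have := Finset.singleton_injective h
    omega
  let B : Finset (Finset (Fin (r + 1)) × Finset ℕ) := {(univ.erase (Fin.last r), range (s + 2))}
  have key : fVec (PP r s m) (r + 1) = (E ∪ (T2 r m (r + 1) \ R) ∪ B).card := by
    apply fVec_eq hm (by omega)
    intro K J
    rw [char_val hr hm (by omega) (by omega), Finset.mem_union, Finset.mem_union, Finset.mem_sdiff,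
      mem_T2, hR, hE]
    simp only [B, Finset.mem_singleton, Prod.mk.injEq]
    constructor
    · rintro ((⟨h1, h2⟩ | ⟨⟨h1, j, hj, h2⟩, h3⟩) | h)
      · right; left
        have hne := (er_ne r).symm
        rcases h2 with h2 | h2
        · exact ⟨0, by omega, h2, by rw [h1, hu], fun _ => Or.inl rfl, fun _ => Or.inl rfl⟩
        · exact ⟨m, by omega, h2, by rw [h1, hu], fun _ => Or.inr rfl, fun _ => Or.inr hm⟩
      · refine Or.inr (Or.inr (Or.inl ⟨j, hj, h2, by omega, ?_⟩))
        intro h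
        by_contra hc
        exact h3 ⟨h, j, by omega, h2⟩
      · exact Or.inr (Or.inr (Or.inr ⟨trivial, h⟩))
    · rintro (⟨h1, h2⟩ | ⟨j, hj, h1, h2, h3, h4⟩ | ⟨j, hj, h1, h2, h3⟩ | ⟨_, h⟩)
      · exfalso
        have := Finset.card_le_univ K
        simp at this
        omega
      · left; left
        have hK : K = univ := by
          rw [← Finset.card_eq_iff_eq_univ]; simpa using h2
        refine ⟨hK, ?_⟩
        rcases h3 hK with rfl | rfl
        · exact Or.inl h1
        · exact Or.inr h1
      · left; right
        refine ⟨⟨by omega, j, hj, h1⟩, ?_⟩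
        rintro ⟨h5, j', h6, h8⟩
        have : j = j' := pr_inj (h1.symm.trans h8)
        have := h3 h5
        omega
      · exact Or.inr h
  have hd1 : Disjoint (E ∪ (T2 r m (r + 1) \ R)) B := by
    rw [Finset.disjoint_left]
    rintro ⟨K, J⟩ h1 h2
    simp only [B, Finset.mem_singleton, Prod.mk.injEq] at h2
    rw [Finset.mem_union, Finset.mem_sdiff, hE, hR, mem_T2] at h1
    rcases h1 with ⟨h1, _⟩ | ⟨⟨_, j, hj, h3⟩, h4⟩
    · exact er_ne r (h2.1.symm.trans h1)
    · apply h4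
      refine ⟨h2.1, j, ?_, h3⟩
      have : j + 1 ∈ range (s + 2) := by
        rw [← h2.2, h3]; simp
      rw [Finset.mem_range] at this
      omega
  have hd2 : Disjoint E (T2 r m (r + 1) \ R) := by
    rw [Finset.disjoint_left]
    rintro ⟨K, J⟩ h1 h2
    rw [hE] at h1
    rw [Finset.mem_sdiff, mem_T2] at h2
    have := h2.1.1
    rw [h1.1, hu] at this
    omega
  have h1 := Finset.card_sdiff_add_card_eq_card hsub
  rw [card_T2, hRc] at h1
  have hBc : B.card = 1 := by simp [B]
  rw [key, Finset.card_union_of_disjoint hd1, Finset.card_union_of_disjoint hd2, hEc, hBc]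
  have h2 : (r + 1).choose (r + 1 - 1) = r + 1 := by simp
  rw [h2] at h1
  omega

theorem arith (r m i : ℕ) (hi : 1 ≤ i) (hi' : i ≤ r) :
    (((r + 1).choose (i + 1) + (r + 1).choose i * (m + 1) + (r + 1).choose (i - 1) * m : ℕ) : ℤ)
      = ((r + 2).choose i : ℤ) * ((r + 2 + m : ℕ) : ℤ) - ((r + 2 + 1).choose (i + 1) : ℤ) * i := by
  obtain ⟨t, rfl⟩ : ∃ t, i = t + 1 := ⟨i - 1, by omega⟩
  have h := Nat.choose_succ_right_eq (r + 2) (t + 1)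
  have e1 : (r + 2).choose (t + 1) = (r + 1).choose t + (r + 1).choose (t + 1) :=
    Nat.choose_succ_succ _ _
  have e2 : (r + 2).choose (t + 1 + 1) = (r + 1).choose (t + 1) + (r + 1).choose (t + 1 + 1) :=
    Nat.choose_succ_succ _ _
  have e3 : (r + 2 + 1).choose (t + 1 + 1) = (r + 2).choose (t + 1) + (r + 2).choose (t + 1 + 1) :=
    Nat.choose_succ_succ _ _
  obtain ⟨u, hu⟩ : ∃ u, r + 2 = u + (t + 1) := ⟨r + 2 - (t + 1), by omega⟩
  have hu' : r + 2 - (t + 1) = u := by omega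
  rw [hu'] at h
  rw [e3]
  rw [e1, e2] at h ⊢
  have hz : (r : ℤ) = u + t - 1 := by push_cast [← Nat.cast_inj (R := ℤ)] at hu; linarith
  simp only [Nat.add_sub_cancel]
  push_cast [← Nat.cast_inj (R := ℤ)] at h ⊢
  rw [hz]
  linear_combination h

theorem memASP_PP {r s m : ℕ} (hr : 1 ≤ r) (hm : s + 1 ≤ m) :
    MemASP (r + 2) (r + 2 + m) s (PP r s m) := by
  classical
  have hV : Val r s m (univ.erase (Fin.last r)) (range (s + 2)) :=
    Or.inr (Or.inr ⟨rfl, Or.inr (Or.inr (Or.inr rfl))⟩)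
  refine ⟨?_, hul r s (univ.erase (Fin.last r)) (range (s + 2)), ⟨?_, ?_, ⟨?_, ?_, ?_⟩, ?_⟩, ?_⟩
  · rw [PP, verts_card hr hm _ _ (Finset.Subset.refl _)]
    simp; omega
  · refine ⟨(ix univ (range (m + 1))).image (pt r s), ?_⟩
    rw [PP, hul, Finset.coe_image]
  · exact dim_full (by omega)
  · rw [isFace_iff]
    exact ⟨_, _, expo_of_val hm hV, rfl⟩
  · apply hul_nonempty
    exact ⟨Sum.inr 0, by simp [ix]⟩
  · rw [dim_big hm]; omega
  · rintro G ⟨hG, _, hG2⟩ hne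
    rw [isFace_iff] at hG
    obtain ⟨K, J, hE, rfl⟩ := hG
    have hJ : J ⊆ range (m + 1) := by
      obtain ⟨_, _, _, _, _, _, hJ⟩ := hE
      intro j hj
      have := ((hJ j).1 hj).1
      rw [Finset.mem_range]; omega
    rw [verts_card hr hm _ _ hJ]
    rcases dim_of_val (i := r + 1) hm (by omega) le_rfl (val_of_expo hm hE) hG2 with h | ⟨_, h1, h2⟩
    · exact h.2
    · exact absurd (by rw [h1, h2]) hne
  · rw [verts_card hr hm]
    · rw [card_er, Finset.card_range]; omega
    · intro j hj
      rw [Finset.mem_range] at hj ⊢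
      omega

/-- **Tightness of the lower bounds: existence of minimizers.**
For every `d ≥ 3`, `s ≥ 0`, `n ≥ d+s+1` there is `P ∈ 𝒫(d,n,s)` attaining all the
lower bounds of the LBT for almost simplicial polytopes. -/
theorem lbt_asp_tight (d n s : ℕ) (hd : 3 ≤ d) (hn : d + s + 1 ≤ n) :
    ∃ P : Set (Fin d → ℝ), MemASP d n s P ∧
      (∀ i : ℕ, 1 ≤ i → i ≤ d - 3 →
        (fVec P i : ℤ) = (d.choose i : ℤ) * n - ((d + 1).choose (i + 1) : ℤ) * i) ∧
      ((fVec P (d - 2) : ℤ)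
          = (d.choose (d - 2) : ℤ) * n - ((d + 1).choose (d - 1) : ℤ) * ((d : ℤ) - 2) - s) ∧
      ((fVec P (d - 1) : ℤ)
          = ((d : ℤ) - 1) * n - ((d : ℤ) + 1) * ((d : ℤ) - 2) - s) := by
  obtain ⟨r, rfl⟩ : ∃ r, d = r + 2 := ⟨d - 2, by omega⟩
  obtain ⟨m, rfl⟩ : ∃ m, n = r + 2 + m := ⟨n - (r + 2), by omega⟩
  have hr : 1 ≤ r := by omega
  have hm : s + 1 ≤ m := by omega
  refine ⟨PP r s m, memASP_PP hr hm, ?_, ?_, ?_⟩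
  · intro i hi hi'
    rw [fVec_lo hr hm hi (by omega)]
    exact arith r m i hi (by omega)
  · have h1 := fVec_mid hr hm
    have h2 := arith r m r hr le_rfl
    rw [← h1] at h2
    have e1 : r + 2 - 2 = r := by omega
    have e2 : r + 2 + 1 - (0 + 2) = r + 1 := by omega
    have e3 : r + 2 - 1 = r + 1 := by omega
    rw [e1, e3]
    push_cast at h2 ⊢
    linarith
  · have h1 := fVec_hi hr hm
    have e3 : r + 2 - 1 = r + 1 := by omega
    rw [e3]
    have h2 : ((fVec (PP r s m) (r + 1) : ℕ) : ℤ) + s = (r + 1) * m + 2 := by exact_mod_cast h1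
    push_cast
    linarith

end

end ASP
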